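/- arXiv:1206.0722 — 15 statements merged into one kernel-verified Lean document; each statement's English description precedes it below -/
import Mathlib

section
/- Let X be a topological space and κ an infinite cardinal. Then odL(X) ≤ κ if and only if every closed nowhere dense subset Y of X (with the subspace topology) satisfies L(Y) ≤ κ. In particular, X is od-compact iff each of its closed nowhere dense subsets is compact, and od-Lindelöf iff each of its closed nowhere dense subsets is Lindelöf. -/
universe u

open Cardinal

/-- `OdLle X κ`: every cover of `X` by dense open sets has a subcover of
cardinality `< κ`. -/
def OdLle (X : Type u) [TopologicalSpace X] (κ : Cardinal.{u}) : Prop :=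
  ∀ S : Set (Set X), (∀ U ∈ S, IsOpen U ∧ Dense U) → ⋃₀ S = Set.univ →
    ∃ T ⊆ S, #T < κ ∧ ⋃₀ T = Set.univ

/-- `Lle X κ`: every open cover of `X` has a subcover of cardinality `< κ`. -/
def Lle (X : Type u) [TopologicalSpace X] (κ : Cardinal.{u}) : Prop :=
  ∀ S : Set (Set X), (∀ U ∈ S, IsOpen U) → ⋃₀ S = Set.univ →
    ∃ T ⊆ S, #T < κ ∧ ⋃₀ T = Set.univ

/-- An od-cover bound passes to open covers of closed nowhere dense subspaces: enlarge each
member of the cover by the complement of the subspace. -/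
theorem OdLle.lle_of_isNowhereDense {X : Type u} [TopologicalSpace X] {κ : Cardinal.{u}}
    (h : OdLle X κ) {Y : Set X} (hY : IsClosed Y) (hnd : IsNowhereDense Y) (hκ : 0 < κ) :
    Lle Y κ := by
  intro S hS hcov
  rcases S.eq_empty_or_nonempty with rfl | ⟨U₀, hU₀⟩
  · exact ⟨∅, subset_rfl, by simpa using hκ, hcov⟩
  let V : Set Y → Set X := fun U => Yᶜ ∪ Subtype.val '' U
  have hpre : ∀ U, Subtype.val ⁻¹' V U = U := by
    intro U
    ext y
    simp [V]
  have hdense : Dense Yᶜ := by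
    rw [← interior_eq_empty_iff_dense_compl, ← hY.closure_eq]
    exact hnd
  obtain ⟨T, hTS, hT, hTcov⟩ := h (V '' S) (by
    rintro _ ⟨U, hU, rfl⟩
    refine ⟨?_, hdense.mono Set.subset_union_left⟩
    obtain ⟨W, hW, rfl⟩ := isOpen_induced_iff.1 (hS U hU)
    have hV : V (Subtype.val ⁻¹' W) = Yᶜ ∪ W := by
      ext x
      by_cases hx : x ∈ Y <;> simp [V, hx]
    exact hV ▸ hY.isOpen_compl.union hW) (by
    refine Set.eq_univ_of_forall fun x => ?_
    by_cases hx : x ∈ Y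
    · obtain ⟨U, hU, hxU⟩ : (⟨x, hx⟩ : Y) ∈ ⋃₀ S := hcov ▸ Set.mem_univ _
      exact ⟨V U, ⟨U, hU, rfl⟩, Or.inr ⟨⟨x, hx⟩, hxU, rfl⟩⟩
    · exact ⟨V U₀, ⟨U₀, hU₀, rfl⟩, Or.inl hx⟩)
  refine ⟨(fun W => Subtype.val ⁻¹' W) '' T, ?_, mk_image_le.trans_lt hT, ?_⟩
  · rintro _ ⟨W, hW, rfl⟩
    obtain ⟨U, hU, rfl⟩ := hTS hW
    simpa only [hpre] using hU
  · refine Set.eq_univ_of_forall fun y => ?_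
    obtain ⟨W, hW, hyW⟩ : (y : X) ∈ ⋃₀ T := hTcov ▸ Set.mem_univ _
    exact ⟨_, ⟨W, hW, rfl⟩, hyW⟩

/-- If all closed nowhere dense subspaces satisfy the cover bound, then so do the covers by dense
open sets: cover the complement of one fixed member. -/
theorem odLle_of_forall_lle {X : Type u} [TopologicalSpace X] {κ : Cardinal.{u}} (hκ : ℵ₀ ≤ κ)
    (h : ∀ Y : Set X, IsClosed Y → IsNowhereDense Y → Lle Y κ) : OdLle X κ := by
  intro S hS hcov
  rcases S.eq_empty_or_nonempty with rfl | ⟨U₀, hU₀⟩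
  · exact ⟨∅, subset_rfl, by simpa using aleph0_pos.trans_le hκ, hcov⟩
  obtain ⟨hopen, hdense⟩ := hS U₀ hU₀
  have hnd : IsNowhereDense U₀ᶜ := by
    rw [IsNowhereDense, hopen.isClosed_compl.closure_eq, interior_eq_empty_iff_dense_compl,
      compl_compl]
    exact hdense
  obtain ⟨T, hTS, hT, hTcov⟩ := h U₀ᶜ hopen.isClosed_compl hnd
    ((fun U => Subtype.val ⁻¹' U) '' S) (by
      rintro _ ⟨U, hU, rfl⟩
      exact (hS U hU).1.preimage continuous_subtype_val) (by
      refine Set.eq_univ_of_forall fun y => ?_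
      obtain ⟨U, hU, hyU⟩ : (y : X) ∈ ⋃₀ S := hcov ▸ Set.mem_univ _
      exact ⟨_, ⟨U, hU, rfl⟩, hyU⟩)
  choose g hgS hg using fun W : T => hTS W.2
  refine ⟨insert U₀ (Set.range g), ?_, ?_, ?_⟩
  · rintro _ (rfl | ⟨W, rfl⟩)
    exacts [hU₀, hgS W]
  · exact mk_insert_le.trans_lt
      (add_lt_of_lt hκ (mk_range_le.trans_lt hT) (one_lt_aleph0.trans_le hκ))
  · refine Set.eq_univ_of_forall fun x => ?_
    by_cases hx : x ∈ U₀
    · exact ⟨U₀, Set.mem_insert _ _, hx⟩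
    · obtain ⟨W, hW, hxW⟩ : (⟨x, hx⟩ : (U₀ᶜ : Set X)) ∈ ⋃₀ T := hTcov ▸ Set.mem_univ _
      exact ⟨g ⟨W, hW⟩, Or.inr ⟨_, rfl⟩, (Set.ext_iff.1 (hg ⟨W, hW⟩) ⟨x, hx⟩).2 hxW⟩

theorem stmt_0 (X : Type u) [TopologicalSpace X] (κ : Cardinal.{u}) (hκ : ℵ₀ ≤ κ) :
    OdLle X κ ↔ ∀ Y : Set X, IsClosed Y → IsNowhereDense Y → Lle Y κ :=
  ⟨fun h _ hY hnd => h.lle_of_isNowhereDense hY hnd (aleph0_pos.trans_le hκ),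
    odLle_of_forall_lle hκ⟩
end

section
/- Let X be a topological space and κ an infinite cardinal. Then odL(X) ≤ κ if and only if odL(Y) ≤ κ for every closed subset Y of X (with the subspace topology). -/
universe u

open Cardinal

/-- `LinLle X κ`: every open cover of `X` that is a chain under inclusion has a
subcover of cardinality `< κ`. -/
def LinLle (X : Type u) [TopologicalSpace X] (κ : Cardinal.{u}) : Prop :=
  ∀ S : Set (Set X), (∀ U ∈ S, IsOpen U) → IsChain (· ⊆ ·) S → ⋃₀ S = Set.univ →
    ∃ T ⊆ S, #T < κ ∧ ⋃₀ T = Set.univ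

/-- `OdCompact X`: every cover of `X` by dense open sets has a finite subcover. -/
def OdCompact (X : Type u) [TopologicalSpace X] : Prop :=
  ∀ S : Set (Set X), (∀ U ∈ S, IsOpen U ∧ Dense U) → ⋃₀ S = Set.univ →
    ∃ T ⊆ S, T.Finite ∧ ⋃₀ T = Set.univ

/-- The union of a dense open subset of a closed set `Y` with the complement of `Y` is dense
open. -/
theorem isOpen_and_dense_image_val_union_compl {X : Type u} [TopologicalSpace X] {Y : Set X}
    (hY : IsClosed Y) {U : Set Y} (hU : IsOpen U) (hd : Dense U) :
    IsOpen (Subtype.val '' U ∪ Yᶜ) ∧ Dense (Subtype.val '' U ∪ Yᶜ) := by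
  constructor
  · obtain ⟨V, hV, rfl⟩ := isOpen_induced_iff.1 hU
    have h : Subtype.val '' ((Subtype.val : Y → X) ⁻¹' V) ∪ Yᶜ = V ∪ Yᶜ := by
      ext x
      by_cases hx : x ∈ Y <;> simp [hx]
    rw [h]
    exact hV.union hY.isOpen_compl
  · intro x
    by_cases hx : x ∈ Y
    · exact closure_mono Set.subset_union_left (closure_subtype.1 (hd ⟨x, hx⟩))
    · exact subset_closure (Or.inr hx)

theorem OdLle.of_isClosed {X : Type u} [TopologicalSpace X] {κ : Cardinal.{u}}
    (hκ : 0 < κ) (hX : OdLle X κ) {Y : Set X} (hY : IsClosed Y) : OdLle Y κ := by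
  intro S hS hcov
  obtain rfl | ⟨U₀, hU₀⟩ := S.eq_empty_or_nonempty
  · exact ⟨∅, subset_rfl, by simpa using hκ, hcov⟩
  let f : Set Y → Set X := fun U => Subtype.val '' U ∪ Yᶜ
  have hf : ∀ U, Subtype.val ⁻¹' f U = U := fun U => by
    ext x
    simp [f]
  obtain ⟨T, hTS, hTκ, hT⟩ := hX (f '' S)
    (by
      rintro _ ⟨U, hU, rfl⟩
      exact isOpen_and_dense_image_val_union_compl hY (hS U hU).1 (hS U hU).2)
    (by
      refine Set.eq_univ_of_forall fun x => ?_
      by_cases hx : x ∈ Y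
      · obtain ⟨U, hU, hxU⟩ := Set.mem_sUnion.1 (hcov ▸ Set.mem_univ (⟨x, hx⟩ : Y))
        exact ⟨f U, ⟨U, hU, rfl⟩, Or.inl ⟨_, hxU, rfl⟩⟩
      · exact ⟨f U₀, ⟨U₀, hU₀, rfl⟩, Or.inr hx⟩)
  refine ⟨(fun V => Subtype.val ⁻¹' V) '' T, ?_, mk_image_le.trans_lt hTκ, ?_⟩
  · rintro _ ⟨V, hV, rfl⟩
    obtain ⟨U, hU, rfl⟩ := hTS hV
    simpa only [hf] using hU
  · refine Set.eq_univ_of_forall fun x => ?_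
    obtain ⟨V, hV, hxV⟩ := Set.mem_sUnion.1 (hT ▸ Set.mem_univ (x : X))
    exact ⟨_, ⟨V, hV, rfl⟩, hxV⟩

theorem OdLle.of_homeomorph {X Y : Type u} [TopologicalSpace X] [TopologicalSpace Y]
    {κ : Cardinal.{u}} (e : X ≃ₜ Y) (hX : OdLle X κ) : OdLle Y κ := by
  intro S hS hcov
  obtain ⟨T, hTS, hTκ, hT⟩ := hX ((fun U => e ⁻¹' U) '' S)
    (by
      rintro _ ⟨U, hU, rfl⟩
      exact ⟨(hS U hU).1.preimage e.continuous, (hS U hU).2.preimage e.isOpenMap⟩)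
    (by
      refine Set.eq_univ_of_forall fun x => ?_
      obtain ⟨U, hU, hxU⟩ := Set.mem_sUnion.1 (hcov ▸ Set.mem_univ (e x))
      exact ⟨_, ⟨U, hU, rfl⟩, hxU⟩)
  refine ⟨(fun V => e '' V) '' T, ?_, mk_image_le.trans_lt hTκ, ?_⟩
  · rintro _ ⟨V, hV, rfl⟩
    obtain ⟨U, hU, rfl⟩ := hTS hV
    simpa only [e.image_preimage] using hU
  · refine Set.eq_univ_of_forall fun y => ?_
    obtain ⟨V, hV, hyV⟩ := Set.mem_sUnion.1 (hT ▸ Set.mem_univ (e.symm y))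
    exact ⟨_, ⟨V, hV, rfl⟩, _, hyV, e.apply_symm_apply y⟩

theorem stmt_1 (X : Type u) [TopologicalSpace X] (κ : Cardinal.{u}) (hκ : ℵ₀ ≤ κ) :
    OdLle X κ ↔ ∀ Y : Set X, IsClosed Y → OdLle Y κ := by
  exact ⟨fun h Y hY => h.of_isClosed (aleph0_pos.trans_le hκ) hY,
    fun h => (h Set.univ isClosed_univ).of_homeomorph (Homeomorph.Set.univ X)⟩
end

section
/- Let κ be an infinite cardinal and let X be a topological space which is a finite union X = X₀ ∪ ⋯ ∪ Xₙ of closed subsets with odL(Xᵢ) ≤ κ for each i (each Xᵢ with the subspace topology). Then odL(X) ≤ κ. -/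
universe u

open Cardinal

/-- A finite union of sets of cardinality less than an infinite cardinal `κ` has cardinality
less than `κ`. -/
theorem mk_biUnion_finset_lt {ι : Type*} {α : Type u} {κ : Cardinal.{u}} (hκ : ℵ₀ ≤ κ)
    (s : Finset ι) {T : ι → Set α} (hT : ∀ i, #(T i) < κ) : #(⋃ i ∈ s, T i : Set α) < κ := by
  classical
  induction s using Finset.induction_on with
  | empty => simpa using aleph0_pos.trans_le hκ
  | insert a s _ ih =>
    rw [Finset.set_biUnion_insert]
    exact (mk_union_le _ _).trans_lt (add_lt_of_lt hκ (hT a) ih)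

/-- A nonempty open set covered by finitely many closed sets meets the interior of one of them. -/
theorem exists_inter_interior_nonempty_of_subset_biUnion {ι X : Type*} [TopologicalSpace X]
    {C : ι → Set X} (hC : ∀ i, IsClosed (C i)) (s : Finset ι) {W : Set X} (hW : IsOpen W)
    (hne : W.Nonempty) (hsub : W ⊆ ⋃ i ∈ s, C i) : ∃ i, (W ∩ interior (C i)).Nonempty := by
  classical
  induction s using Finset.induction_on generalizing W with
  | empty =>
    obtain ⟨x, hx⟩ := hne
    simpa using hsub hx
  | insert a s _ ih =>
    rcases (W \ C a).eq_empty_or_nonempty with h | h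
    · refine ⟨a, ?_⟩
      rwa [Set.inter_eq_left.2 (interior_maximal (Set.sdiff_eq_empty.1 h) hW)]
    · obtain ⟨i, x, hx, hxi⟩ := ih (hW.sdiff (hC a)) h fun x hx => by
        have := hsub hx.1
        rw [Finset.set_biUnion_insert] at this
        exact this.resolve_left hx.2
      exact ⟨i, x, hx.1, hxi⟩

/-- The regular parts of the members of a finite closed cover still form a cover. -/
theorem iUnion_closure_interior_eq_univ {ι X : Type*} [Finite ι] [TopologicalSpace X]
    {C : ι → Set X} (hC : ∀ i, IsClosed (C i)) (hcover : ⋃ i, C i = Set.univ) :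
    ⋃ i, closure (interior (C i)) = Set.univ := by
  have := Fintype.ofFinite ι
  rw [← closure_iUnion_of_finite, ← dense_iff_closure_eq, dense_iff_inter_open]
  intro W hW hne
  obtain ⟨i, x, hx, hxi⟩ := exists_inter_interior_nonempty_of_subset_biUnion hC Finset.univ hW hne
    (by simp [hcover])
  exact ⟨x, hx, Set.mem_iUnion.2 ⟨i, hxi⟩⟩

/-- The trace on `C` of a dense open set becomes dense in `C` once the complement of the
regular part of `C` is added. -/
theorem dense_preimage_val_union_compl_closure_interior {X : Type*} [TopologicalSpace X]
    (C : Set X) {U : Set X} (hU : Dense U) :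
    Dense ((↑) ⁻¹' (U ∪ (closure (interior C))ᶜ) : Set C) := by
  rw [dense_iff_inter_open]
  rintro _ ⟨W, hW, rfl⟩ ⟨x, hx⟩
  by_cases hxR : (x : X) ∈ closure (interior C)
  · obtain ⟨y, ⟨hyW, hyC⟩, hyU⟩ := hU.inter_open_nonempty _ (hW.inter isOpen_interior)
      (mem_closure_iff.1 hxR W hW hx)
    exact ⟨⟨y, interior_subset hyC⟩, hyW, Or.inl hyU⟩
  · exact ⟨x, hx, Or.inr hxR⟩

/-- If `OdLle C κ`, then, given a member `U` of a cover of `X` by dense open sets, fewer than `κ`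
members cover the part of the regular part of `C` lying outside `U`. -/
theorem OdLle.exists_subset_closure_interior_diff_subset {X : Type u} [TopologicalSpace X]
    {κ : Cardinal.{u}} {C : Set X} (hC : OdLle C κ) {S : Set (Set X)}
    (hS : ∀ V ∈ S, IsOpen V ∧ Dense V) (hcover : ⋃₀ S = Set.univ) {U : Set X} (hU : U ∈ S) :
    ∃ T ⊆ S, #T < κ ∧ (closure (interior C) ∩ C) \ U ⊆ ⋃₀ T := by
  let f : Set X → Set C := fun V => (↑) ⁻¹' (V ∪ (U ∪ (closure (interior C))ᶜ))
  obtain ⟨T, hTS, hT, hTc⟩ := hC (f '' S)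
    (by
      rintro _ ⟨V, hV, rfl⟩
      exact ⟨((hS V hV).1.union ((hS U hU).1.union isClosed_closure.isOpen_compl)).preimage
        continuous_subtype_val,
        (dense_preimage_val_union_compl_closure_interior C (hS U hU).2).mono
          (Set.preimage_mono Set.subset_union_right)⟩)
    (by
      refine Set.eq_univ_of_forall fun x => ?_
      obtain ⟨V, hV, hxV⟩ := Set.mem_sUnion.1 (hcover ▸ Set.mem_univ (x : X))
      exact ⟨f V, ⟨V, hV, rfl⟩, Or.inl hxV⟩)
  choose g hgS hg using hTS
  refine ⟨Set.range fun V : T => g V.2, ?_, mk_range_le.trans_lt hT, ?_⟩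
  · rintro _ ⟨V, rfl⟩
    exact hgS V.2
  · rintro x ⟨⟨hxR, hxC⟩, hxU⟩
    obtain ⟨V, hV, hxV⟩ := Set.mem_sUnion.1 (hTc ▸ Set.mem_univ (⟨x, hxC⟩ : C))
    rw [← hg hV] at hxV
    refine ⟨g hV, ⟨⟨V, hV⟩, rfl⟩, ?_⟩
    rcases hxV with h | h | h
    · exact h
    · exact absurd h hxU
    · exact absurd hxR h

theorem stmt_2 (X : Type u) [TopologicalSpace X] (κ : Cardinal.{u}) (hκ : ℵ₀ ≤ κ)
    (n : ℕ) (Xs : Fin (n + 1) → Set X)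
    (hclosed : ∀ i, IsClosed (Xs i))
    (hod : ∀ i, OdLle (Xs i) κ)
    (hcover : ⋃ i, Xs i = Set.univ) :
    OdLle X κ := by
  intro S hS hSc
  rcases S.eq_empty_or_nonempty with rfl | ⟨U, hU⟩
  · exact ⟨∅, subset_rfl, by simpa using aleph0_pos.trans_le hκ, hSc⟩
  choose T hTS hT hTc using fun i =>
    (hod i).exists_subset_closure_interior_diff_subset hS hSc hU
  refine ⟨{U} ∪ ⋃ i, T i, ?_, ?_, ?_⟩
  · exact Set.union_subset (Set.singleton_subset_iff.2 hU) (Set.iUnion_subset hTS)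
  · refine (mk_union_le _ _).trans_lt (add_lt_of_lt hκ ?_ ?_)
    · simpa using one_lt_aleph0.trans_le hκ
    · simpa using mk_biUnion_finset_lt hκ Finset.univ hT
  · refine Set.eq_univ_of_forall fun x => ?_
    by_cases hxU : x ∈ U
    · exact ⟨U, Or.inl rfl, hxU⟩
    obtain ⟨i, hi⟩ := Set.mem_iUnion.1
      (iUnion_closure_interior_eq_univ hclosed hcover ▸ Set.mem_univ x)
    obtain ⟨V, hV, hxV⟩ := hTc i
      ⟨⟨hi, (hclosed i).closure_interior_subset hi⟩, hxU⟩
    exact ⟨V, Or.inr (Set.mem_iUnion.2 ⟨i, hV⟩), hxV⟩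
end

section
/- Let κ be an infinite cardinal and X a topological space with X = X₀ ∪ X₁, where X₀ is closed in X with L(X₀) ≤ κ and odL(X₁) ≤ κ (subspace topologies). Then odL(X) ≤ κ. -/
universe u

open Cardinal

/-- A subset of an image `f '' S` is the image of a subset of `S` of the same cardinality. -/
theorem exists_subset_image_eq_mk_eq {α β : Type u} {f : α → β} {S : Set α} {T : Set β}
    (h : T ⊆ f '' S) : ∃ R ⊆ S, f '' R = T ∧ #R = #T := by
  obtain ⟨R, hRS, hR⟩ := Set.SurjOn.exists_bijOn_subset h
  exact ⟨R, hRS, hR.image_eq, by rw [← hR.image_eq, mk_image_eq_of_injOn f R hR.injOn]⟩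

theorem stmt_3 (X : Type u) [TopologicalSpace X] (κ : Cardinal.{u}) (hκ : ℵ₀ ≤ κ)
    (X₀ X₁ : Set X) (hunion : X₀ ∪ X₁ = Set.univ)
    (hclosed : IsClosed X₀) (hL : Lle X₀ κ) (hod : OdLle X₁ κ) :
    OdLle X κ := by
  intro S hS hcov
  have hmem (x : X) : ∃ U ∈ S, x ∈ U := by
    rw [← Set.mem_sUnion, hcov]
    trivial
  obtain ⟨T, hTS, hTκ, hT⟩ := hL ((fun U => Subtype.val ⁻¹' U) '' S)
    (by
      rintro _ ⟨U, hU, rfl⟩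
      exact (hS U hU).1.preimage continuous_subtype_val)
    (by
      refine Set.eq_univ_of_forall fun x => ?_
      obtain ⟨U, hU, hx⟩ := hmem x
      exact ⟨_, ⟨U, hU, rfl⟩, hx⟩)
  obtain ⟨A, hAS, rfl, hA⟩ := exists_subset_image_eq_mk_eq hTS
  have hX₀ : X₀ ⊆ ⋃₀ A := by
    intro x hx
    obtain ⟨_, ⟨U, hU, rfl⟩, hxU⟩ := hT.symm ▸ Set.mem_univ (⟨x, hx⟩ : X₀)
    exact ⟨U, hU, hxU⟩
  have hAo : IsOpen (⋃₀ A) := isOpen_sUnion fun U hU => (hS U (hAS hU)).1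
  -- Traces of members of `S` need not be dense in `X₁`; they become so after adjoining `⋃₀ A`.
  obtain ⟨T', hTS', hTκ', hT'⟩ := hod ((fun U => Subtype.val ⁻¹' (U ∪ ⋃₀ A)) '' S)
    (by
      rintro _ ⟨U, hU, rfl⟩
      refine ⟨((hS U hU).1.union hAo).preimage continuous_subtype_val, fun x => ?_⟩
      by_cases hx : (x : X) ∈ X₀
      · exact subset_closure (Or.inr (hX₀ hx))
      · rw [mem_closure_iff]
        rintro _ ⟨O, hO, rfl⟩ hxO
        obtain ⟨y, ⟨hyO, hy⟩, hyU⟩ := (hS U hU).2.inter_open_nonempty _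
          (hO.inter hclosed.isOpen_compl) ⟨x, hxO, hx⟩
        have hy₁ : y ∈ X₁ := (hunion.symm ▸ Set.mem_univ y : y ∈ X₀ ∪ X₁).resolve_left hy
        exact ⟨⟨y, hy₁⟩, hyO, Or.inl hyU⟩)
    (by
      refine Set.eq_univ_of_forall fun x => ?_
      obtain ⟨U, hU, hx⟩ := hmem x
      exact ⟨_, ⟨U, hU, rfl⟩, Or.inl hx⟩)
  obtain ⟨B, hBS, rfl, hB⟩ := exists_subset_image_eq_mk_eq hTS'
  refine ⟨A ∪ B, Set.union_subset hAS hBS, (mk_union_le A B).trans_lt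
    (add_lt_of_lt hκ (hA ▸ hTκ) (hB ▸ hTκ')), Set.eq_univ_of_forall fun x => ?_⟩
  rw [Set.sUnion_union]
  rcases (hunion.symm ▸ Set.mem_univ x : x ∈ X₀ ∪ X₁) with hx | hx
  · exact Or.inl (hX₀ hx)
  · obtain ⟨_, ⟨U, hU, rfl⟩, hxU | hxA⟩ := hT'.symm ▸ Set.mem_univ (⟨x, hx⟩ : X₁)
    · exact Or.inr ⟨U, hU, hxU⟩
    · exact Or.inl hxA
end

section
/- Let κ be an infinite cardinal and X a Hausdorff topological space with X = X₀ ∪ X₁, where X₀ is compact (in the subspace topology) and odL(X₁) ≤ κ. Then odL(X) ≤ κ. -/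
universe u

open Cardinal

theorem stmt_4 (X : Type u) [TopologicalSpace X] [T2Space X] (κ : Cardinal.{u}) (hκ : ℵ₀ ≤ κ)
    (X₀ X₁ : Set X) (hunion : X₀ ∪ X₁ = Set.univ)
    (hcompact : IsCompact X₀) (hod : OdLle X₁ κ) :
    OdLle X κ := by
  intro S hS hcover
  obtain ⟨F, hFS, hFfin, hF⟩ := hcompact.elim_finite_subcover_image (b := S) (c := id)
    (fun U hU => (hS U hU).1)
    (by simp only [id, ← Set.sUnion_eq_biUnion, hcover, Set.subset_univ])
  replace hF : X₀ ⊆ ⋃₀ F := by rwa [Set.sUnion_eq_biUnion]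
  -- Enlarging each member of `S` by `⋃₀ F ⊇ X₀` makes its trace on `X₁` dense.
  have hFopen : IsOpen (⋃₀ F) := isOpen_sUnion fun U hU => (hS U (hFS hU)).1
  let f : Set X → Set X₁ := fun U => Subtype.val ⁻¹' (U ∪ ⋃₀ F)
  have hdense : ∀ U ∈ S, Dense (f U) := by
    intro U hU x
    by_cases hx : (x : X) ∈ X₀
    · exact subset_closure (Or.inr (hF hx))
    rw [mem_closure_iff]
    intro W hW hxW
    obtain ⟨O, hO, rfl⟩ := isOpen_induced_iff.1 hW
    obtain ⟨y, ⟨hyO, hyX₀⟩, hyU⟩ := (hS U hU).2.inter_open_nonempty (O ∩ X₀ᶜ)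
      (hO.inter hcompact.isClosed.isOpen_compl) ⟨x, hxW, hx⟩
    have hy : y ∈ X₁ := (hunion.symm ▸ Set.mem_univ y : y ∈ X₀ ∪ X₁).resolve_left hyX₀
    exact ⟨⟨y, hy⟩, hyO, Or.inl hyU⟩
  obtain ⟨T', hT'S, hT'card, hT'⟩ := hod (f '' S)
    (by
      rintro _ ⟨U, hU, rfl⟩
      exact ⟨((hS U hU).1.union hFopen).preimage continuous_subtype_val, hdense U hU⟩)
    (by
      refine Set.eq_univ_of_forall fun x => ?_
      obtain ⟨U, hU, hxU⟩ := (hcover.symm ▸ Set.mem_univ (x : X) : (x : X) ∈ ⋃₀ S)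
      exact ⟨f U, ⟨U, hU, rfl⟩, Or.inl hxU⟩)
  choose g hgS hg using fun A : T' => hT'S A.2
  refine ⟨Set.range g ∪ F, Set.union_subset (Set.range_subset_iff.2 hgS) hFS, ?_, ?_⟩
  · exact (mk_union_le _ _).trans_lt
      (add_lt_of_lt hκ (mk_range_le.trans_lt hT'card) (hFfin.lt_aleph0.trans_le hκ))
  · refine Set.eq_univ_of_forall fun x => ?_
    rw [Set.sUnion_union]
    rcases (hunion.symm ▸ Set.mem_univ x : x ∈ X₀ ∪ X₁) with hx | hx
    · exact Or.inr (hF hx)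
    obtain ⟨A, hA, hxA⟩ := (hT'.symm ▸ Set.mem_univ _ : (⟨x, hx⟩ : X₁) ∈ ⋃₀ T')
    have hxA' : (⟨x, hx⟩ : X₁) ∈ f (g ⟨A, hA⟩) := by rwa [hg]
    exact hxA'.imp_left fun h => ⟨_, Set.mem_range_self _, h⟩
end

section
/- Let τ be an infinite cardinal and X a topological space. If there is an open subset U ⊆ X with L(U) ≤ τ but whose closure satisfies L(closure U) > τ (subspace topologies), then odL(X) > τ. -/
universe u

open Cardinal

/-- A subset of an image is the image of a subset of no larger cardinality. -/
theorem exists_subset_image_eq_mk_le {α β : Type u} (f : α → β) {S : Set α} {T : Set β}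
    (hT : T ⊆ f '' S) : ∃ R ⊆ S, #R ≤ #T ∧ f '' R = T := by
  choose g hgS hg using hT
  refine ⟨Set.range fun t : T => g t.2, ?_, mk_range_le, ?_⟩
  · rintro _ ⟨t, rfl⟩
    exact hgS t.2
  · ext b
    constructor
    · rintro ⟨_, ⟨t, rfl⟩, rfl⟩
      rw [hg t.2]
      exact t.2
    · intro hb
      exact ⟨g hb, ⟨⟨b, hb⟩, rfl⟩, hg hb⟩

theorem dense_union_compl_closure {X : Type u} [TopologicalSpace X] (U : Set X) :
    Dense (U ∪ (closure U)ᶜ) := by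
  rw [dense_iff_closure_eq, closure_union, Set.eq_univ_iff_forall]
  intro x
  by_cases hx : x ∈ closure U
  · exact Or.inl hx
  · exact Or.inr (subset_closure hx)

/-- If `U` is open and both `odL(X)` and `L(U)` are at most `τ`, then so is `L(closure U)`. -/
theorem OdLle.lle_closure {X : Type u} [TopologicalSpace X] {τ : Cardinal.{u}} (hτ : ℵ₀ ≤ τ)
    {U : Set X} (hU : IsOpen U) (hL : Lle U τ) (hX : OdLle X τ) : Lle (closure U) τ := by
  intro S hS hcov
  rcases S.eq_empty_or_nonempty with rfl | ⟨s₀, hs₀⟩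
  · exact ⟨∅, subset_rfl, by simpa using aleph0_pos.trans_le hτ, hcov⟩
  let D : Set (closure U) → Set X := fun s => (↑) '' s ∪ (U ∪ (closure U)ᶜ)
  let i : U → closure U := Set.inclusion subset_closure
  have hD : ∀ V ∈ D '' S, IsOpen V ∧ Dense V := by
    rintro _ ⟨s, hs, rfl⟩
    refine ⟨?_, (dense_union_compl_closure U).mono Set.subset_union_right⟩
    obtain ⟨W, hW, rfl⟩ := isOpen_induced_iff.1 (hS s hs)
    have hDW : D ((↑) ⁻¹' W) = W ∪ (U ∪ (closure U)ᶜ) := by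
      ext x
      by_cases hx : x ∈ closure U <;> simp [D, hx]
    rw [hDW]
    exact hW.union (hU.union isClosed_closure.isOpen_compl)
  have hDcov : ⋃₀ (D '' S) = Set.univ := by
    rw [Set.eq_univ_iff_forall]
    intro x
    by_cases hx : x ∈ closure U
    · obtain ⟨s, hs, hxs⟩ := Set.mem_sUnion.1 (hcov ▸ Set.mem_univ (⟨x, hx⟩ : closure U))
      exact ⟨D s, ⟨s, hs, rfl⟩, Or.inl ⟨_, hxs, rfl⟩⟩
    · exact ⟨D s₀, ⟨s₀, hs₀, rfl⟩, Or.inr (Or.inr hx)⟩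
  have hi : ∀ V ∈ (i ⁻¹' ·) '' S, IsOpen V := by
    rintro _ ⟨s, hs, rfl⟩
    exact (hS s hs).preimage (continuous_inclusion subset_closure)
  have hicov : ⋃₀ ((i ⁻¹' ·) '' S) = Set.univ := by
    rw [Set.sUnion_image, ← Set.preimage_iUnion₂, ← Set.sUnion_eq_biUnion, hcov,
      Set.preimage_univ]
  obtain ⟨A, hAS, hA, hAcov⟩ := hX _ hD hDcov
  obtain ⟨B, hBS, hB, hBcov⟩ := hL _ hi hicov
  obtain ⟨P, hPS, hP, rfl⟩ := exists_subset_image_eq_mk_le D hAS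
  obtain ⟨Q, hQS, hQ, rfl⟩ := exists_subset_image_eq_mk_le (i ⁻¹' ·) hBS
  refine ⟨P ∪ Q, Set.union_subset hPS hQS, (mk_union_le P Q).trans_lt
    (add_lt_of_lt hτ (hP.trans_lt hA) (hQ.trans_lt hB)), ?_⟩
  rw [Set.eq_univ_iff_forall]
  rintro ⟨x, hx⟩
  by_cases hxU : x ∈ U
  · obtain ⟨_, ⟨q, hq, rfl⟩, hxq⟩ := Set.mem_sUnion.1 (hBcov ▸ Set.mem_univ (⟨x, hxU⟩ : U))
    exact ⟨q, Or.inr hq, hxq⟩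
  · obtain ⟨_, ⟨p, hp, rfl⟩, ⟨y, hy, rfl⟩ | h | h⟩ :=
      Set.mem_sUnion.1 (hAcov ▸ Set.mem_univ x)
    · exact ⟨p, Or.inl hp, hy⟩
    · exact absurd h hxU
    · exact absurd hx h

theorem stmt_6 (X : Type u) [TopologicalSpace X] (τ : Cardinal.{u}) (hτ : ℵ₀ ≤ τ)
    (U : Set X) (hU : IsOpen U) (hL : Lle U τ) (hcl : ¬ Lle (closure U) τ) :
    ¬ OdLle X τ := by
  exact fun hX => hcl (hX.lle_closure hτ hU hL)
end

section
/- Let τ be an infinite regular cardinal and let X be a T1 topological space such that every point of X has an open neighborhood U with L(U) ≤ τ, and such that odL(X) ≤ τ. Then either L(X) ≤ τ, or there is a clopen discrete subset of X of cardinality ≥ τ. -/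
universe u

open Cardinal

/-- Every cover of `A` by open sets of the ambient space has a subcover of cardinality `< κ`. -/
def RelLle {X : Type u} [TopologicalSpace X] (A : Set X) (κ : Cardinal.{u}) : Prop :=
  ∀ S : Set (Set X), (∀ U ∈ S, IsOpen U) → A ⊆ ⋃₀ S → ∃ T ⊆ S, #T < κ ∧ A ⊆ ⋃₀ T

theorem exists_subset_mk_le_image_eq {α β : Type u} {f : α → β} {s : Set α} {t : Set β}
    (h : t ⊆ f '' s) : ∃ r ⊆ s, #r ≤ #t ∧ f '' r = t := by
  choose g hgs hg using fun y : t => h y.2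
  refine ⟨Set.range g, ?_, mk_range_le, ?_⟩
  · rintro _ ⟨y, rfl⟩
    exact hgs y
  · ext y
    constructor
    · rintro ⟨_, ⟨z, rfl⟩, rfl⟩
      rw [hg]
      exact z.2
    · exact fun hy => ⟨_, ⟨⟨y, hy⟩, rfl⟩, hg ⟨y, hy⟩⟩

section

variable {X : Type u} [TopologicalSpace X] {κ : Cardinal.{u}}

theorem Lle.relLle {A : Set X} (h : Lle A κ) : RelLle A κ := by
  intro S hS hA
  obtain ⟨T', hT', hcard, hcov⟩ := h ((fun U => Subtype.val ⁻¹' U) '' S)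
    (by
      rintro _ ⟨U, hU, rfl⟩
      exact (hS U hU).preimage continuous_subtype_val)
    (by
      refine Set.eq_univ_of_forall fun x => ?_
      obtain ⟨U, hU, hx⟩ := hA x.2
      exact ⟨_, ⟨U, hU, rfl⟩, hx⟩)
  obtain ⟨T, hTS, hle, rfl⟩ := exists_subset_mk_le_image_eq hT'
  refine ⟨T, hTS, hle.trans_lt hcard, fun x hx => ?_⟩
  obtain ⟨_, ⟨U, hU, rfl⟩, hxU⟩ := Set.eq_univ_iff_forall.1 hcov ⟨x, hx⟩
  exact ⟨U, hU, hxU⟩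

theorem RelLle.biUnion (hκ : κ.IsRegular) {s : Set X} (hs : #s < κ) {A : X → Set X}
    (hA : ∀ i ∈ s, RelLle (A i) κ) : RelLle (⋃ i ∈ s, A i) κ := by
  intro S hS hcov
  have hsub : ∀ i : s, A i ⊆ ⋃₀ S := fun i => (Set.subset_biUnion_of_mem i.2).trans hcov
  choose T hTS hcard hT using fun i : s => hA i i.2 S hS (hsub i)
  refine ⟨⋃ i, T i, Set.iUnion_subset hTS, ?_, ?_⟩
  · exact (mk_iUnion_le_sum_mk).trans_lt (sum_lt_of_isRegular hκ hs hcard)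
  · refine Set.iUnion₂_subset fun i hi x hx => ?_
    obtain ⟨U, hU, hxU⟩ := hT ⟨i, hi⟩ hx
    exact ⟨U, Set.mem_iUnion.2 ⟨_, hU⟩, hxU⟩

theorem RelLle.union (hκ : ℵ₀ ≤ κ) {A B : Set X} (hA : RelLle A κ) (hB : RelLle B κ) :
    RelLle (A ∪ B) κ := by
  intro S hS hcov
  obtain ⟨T, hTS, hT, hAT⟩ := hA S hS (Set.subset_union_left.trans hcov)
  obtain ⟨R, hRS, hR, hBR⟩ := hB S hS (Set.subset_union_right.trans hcov)
  refine ⟨T ∪ R, Set.union_subset hTS hRS, (mk_union_le T R).trans_lt (add_lt_of_lt hκ hT hR), ?_⟩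
  rw [Set.sUnion_union]
  exact Set.union_subset_union hAT hBR

theorem OdLle.relLle (h : OdLle X κ) (hκ : 0 < κ) {F : Set X} (hF : IsClosed F)
    (hint : interior F = ∅) : RelLle F κ := by
  intro S hS hcov
  obtain rfl | ⟨x₀, hx₀⟩ := F.eq_empty_or_nonempty
  · exact ⟨∅, Set.empty_subset _, by simpa using hκ, Set.empty_subset _⟩
  obtain ⟨T', hT', hcard, huniv⟩ := h ((fun U => U ∪ Fᶜ) '' S)
    (by
      rintro _ ⟨U, hU, rfl⟩
      exact ⟨(hS U hU).union hF.isOpen_compl,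
        (interior_eq_empty_iff_dense_compl.1 hint).mono Set.subset_union_right⟩)
    (by
      refine Set.eq_univ_of_forall fun x => ?_
      by_cases hx : x ∈ F
      · obtain ⟨U, hU, hxU⟩ := hcov hx
        exact ⟨_, ⟨U, hU, rfl⟩, Or.inl hxU⟩
      · obtain ⟨U, hU, -⟩ := hcov hx₀
        exact ⟨_, ⟨U, hU, rfl⟩, Or.inr hx⟩)
  obtain ⟨T, hTS, hle, rfl⟩ := exists_subset_mk_le_image_eq hT'
  refine ⟨T, hTS, hle.trans_lt hcard, fun x hx => ?_⟩
  obtain ⟨_, ⟨U, hU, rfl⟩, hxU⟩ := Set.eq_univ_iff_forall.1 huniv x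
  exact ⟨U, hU, hxU.resolve_right fun h => h hx⟩

theorem RelLle.mk_lt {E : Set X} (h : RelLle E κ) (hE : ∀ E' ⊆ E, IsClosed E') : #E < κ := by
  obtain ⟨T, hTS, hcard, hT⟩ := h ((fun e => (E \ {e})ᶜ) '' E)
    (by
      rintro _ ⟨e, -, rfl⟩
      exact (hE _ Set.sdiff_subset).isOpen_compl)
    (fun e he => ⟨_, ⟨e, he, rfl⟩, fun h => h.2 rfl⟩)
  choose t htT ht using fun e : E => hT e.2
  have hteq : ∀ e : E, t e = (E \ {(e : X)})ᶜ := fun e => by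
    obtain ⟨e', -, he'⟩ := hTS (htT e)
    have hmem := ht e
    rw [← he'] at hmem ⊢
    have : (e : X) = e' := by
      by_contra hne
      exact hmem ⟨e.2, hne⟩
    rw [this]
  refine lt_of_le_of_lt (mk_le_of_injective (f := fun e : E => (⟨t e, htT e⟩ : T)) ?_) hcard
  intro a b hab
  have hab : t a = t b := congrArg Subtype.val hab
  have hmem := ht a
  rw [hab, hteq b] at hmem
  by_contra hne
  exact hmem ⟨a.2, fun h => hne (Subtype.ext h)⟩

/-- The members of an open cover indexed by points can be disjointified, up to a nowhere dense
set, by removing from each the closure of the union of the preceding ones. -/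
theorem exists_disjoint_open_dense_refinement (U : X → Set X) (hU : ∀ x, IsOpen (U x))
    (hmem : ∀ x, x ∈ U x) :
    ∃ V : X → Set X, (∀ x, IsOpen (V x)) ∧ (∀ x, V x ⊆ U x) ∧
      Pairwise (Function.onFun Disjoint V) ∧ Dense (⋃ x, V x) := by
  let r : X → X → Prop := WellOrderingRel
  have hwf : WellFounded r := IsWellFounded.wf
  refine ⟨fun x => U x \ closure (⋃ y ∈ {y | r y x}, U y),
    fun x => (hU x).sdiff isClosed_closure, fun x => Set.sdiff_subset, ?_, ?_⟩
  · have key : ∀ x y, r x y → Disjoint (U x \ closure (⋃ z ∈ {z | r z x}, U z))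
        (U y \ closure (⋃ z ∈ {z | r z y}, U z)) := fun x y hxy =>
      Set.disjoint_left.2 fun z hx hy =>
        hy.2 (subset_closure (Set.mem_biUnion (show x ∈ {z | r z y} from hxy) hx.1))
    intro x y hne
    rcases trichotomous_of r x y with hxy | hxy | hxy
    · exact key x y hxy
    · exact absurd hxy hne
    · exact (key y x hxy).symm
  · rw [dense_iff_inter_open]
    rintro O hO ⟨z, hz⟩
    let s : Set X := {x | (O ∩ U x).Nonempty}
    have hs : s.Nonempty := ⟨z, z, hz, hmem z⟩
    obtain ⟨w, hwO, hwU⟩ := hwf.min_mem s hs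
    refine ⟨w, hwO, Set.mem_iUnion.2 ⟨hwf.min s hs, hwU, fun hcl => ?_⟩⟩
    obtain ⟨v, hvO, hv⟩ := mem_closure_iff.1 hcl O hO hwO
    obtain ⟨y, hy, hvy⟩ := Set.mem_iUnion₂.1 hv
    exact hwf.not_lt_min s (show y ∈ s from ⟨v, hvO, hvy⟩) hy

/-- A set whose points lie in a closed set `F`, and which meets each member of an open cover of `F`
in at most one point, is closed. -/
theorem isClosed_of_subsingleton_inter [T1Space X] {ι : Type*} {F E : Set X} {V : ι → Set X}
    (hF : IsClosed F) (hEF : E ⊆ F) (hV : ∀ i, IsOpen (V i)) (hFV : F ⊆ ⋃ i, V i)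
    (hE : ∀ i, (E ∩ V i).Subsingleton) : IsClosed E := by
  rw [← isOpen_compl_iff, isOpen_iff_forall_mem_open]
  intro z hz
  by_cases hzF : z ∈ F
  · obtain ⟨i, hi⟩ := Set.mem_iUnion.1 (hFV hzF)
    exact ⟨V i \ (E ∩ V i), fun w hw hwE => hw.2 ⟨hwE, hw.1⟩,
      (hV i).sdiff (hE i).finite.isClosed, hi, fun h => hz h.1⟩
  · exact ⟨Fᶜ, Set.compl_subset_compl.2 hEF, hF.isOpen_compl, hzF⟩

end

theorem stmt_7 (X : Type u) [TopologicalSpace X] [T1Space X]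
    (τ : Cardinal.{u}) (hτ : τ.IsRegular)
    (hloc : ∀ x : X, ∃ U : Set X, IsOpen U ∧ x ∈ U ∧ Lle U τ)
    (hod : OdLle X τ) :
    Lle X τ ∨ ∃ D : Set X, IsClopen D ∧ DiscreteTopology D ∧ τ ≤ #D := by
  choose U hUo hmem hUL using hloc
  have hUrel : ∀ x, RelLle (U x) τ := fun x => (hUL x).relLle
  obtain ⟨V, hVo, hVU, hVd, hVdense⟩ := exists_disjoint_open_dense_refinement U hUo hmem
  have hKc : IsClosed (⋃ x, V x)ᶜ := (isOpen_iUnion hVo).isClosed_compl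
  have hK : RelLle (⋃ x, V x)ᶜ τ := hod.relLle hτ.pos hKc <| by
    rw [interior_eq_empty_iff_dense_compl, compl_compl]
    exact hVdense
  obtain ⟨T', hT'S, hT'card, hKT'⟩ := hK (U '' Set.univ)
    (by
      rintro _ ⟨x, -, rfl⟩
      exact hUo x)
    (fun x _ => ⟨_, ⟨x, trivial, rfl⟩, hmem x⟩)
  obtain ⟨A, -, hAle, rfl⟩ := exists_subset_mk_le_image_eq hT'S
  rw [Set.sUnion_image] at hKT'
  have hW : RelLle (⋃ x ∈ A, U x) τ :=
    RelLle.biUnion hτ (hAle.trans_lt hT'card) fun x _ => hUrel x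
  set F : Set X := (⋃ x ∈ A, U x)ᶜ
  have hF : IsClosed F := (isOpen_biUnion fun x _ => hUo x).isClosed_compl
  have hFV : F ⊆ ⋃ x, V x := Set.compl_subset_comm.1 hKT'
  let G : Set X := {x | (F ∩ V x).Nonempty}
  choose p hpF hpV using fun x : G => x.2
  have hpinj : Function.Injective p := fun x y hxy => by
    by_contra hne
    exact Set.disjoint_left.1 (hVd fun h => hne (Subtype.ext h)) (hpV x) (hxy ▸ hpV y)
  have hsing : ∀ x, (Set.range p ∩ V x).Subsingleton := by
    have hidx : ∀ (y : G) (x : X), p y ∈ V x → (y : X) = x := fun y x h => by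
      by_contra hne
      exact Set.disjoint_left.1 (hVd hne) (hpV y) h
    rintro x _ ⟨⟨a, rfl⟩, ha⟩ _ ⟨⟨b, rfl⟩, hb⟩
    rw [Subtype.ext ((hidx a x ha).trans (hidx b x hb).symm)]
  have hclosed : ∀ E ⊆ Set.range p, IsClosed E := fun E hE =>
    isClosed_of_subsingleton_inter hF
      (hE.trans (Set.range_subset_iff.2 hpF)) hVo hFV
      fun x => (hsing x).anti (Set.inter_subset_inter_left _ hE)
  let I : Set X := {x | IsOpen {x}}
  have hIopen : ∀ E ⊆ I, IsOpen E := fun E hE => by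
    rw [← Set.biUnion_of_singleton E]
    exact isOpen_biUnion fun x hx => hE hx
  have hnd : #(Set.range p \ I : Set X) < τ := by
    refine RelLle.mk_lt (hod.relLle hτ.pos (hclosed _ Set.sdiff_subset) ?_)
      fun E hE => hclosed E (hE.trans Set.sdiff_subset)
    refine Set.eq_empty_of_forall_notMem fun x hx => ?_
    have hxI : IsOpen {x} := by
      have heq : {x} = interior (Set.range p \ I) \ ((Set.range p \ I) \ {x}) := by
        ext y
        constructor
        · rintro rfl
          exact ⟨hx, fun h => h.2 rfl⟩
        · intro hy
          by_contra hne
          exact hy.2 ⟨interior_subset hy.1, hne⟩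
      rw [heq]
      exact isOpen_interior.sdiff (hclosed _ (Set.sdiff_subset.trans Set.sdiff_subset))
    exact (interior_subset hx).2 hxI
  by_cases hcard : τ ≤ #(Set.range p ∩ I : Set X)
  · refine Or.inr ⟨_, ⟨hclosed _ Set.inter_subset_left, hIopen _ Set.inter_subset_right⟩, ?_, hcard⟩
    refine discreteTopology_iff_isOpen_singleton.2 fun x => ?_
    have : ({x} : Set ↥(Set.range p ∩ I)) = Subtype.val ⁻¹' {(x : X)} := by
      ext y
      simp [Subtype.ext_iff]
    rw [this]
    exact IsOpen.preimage continuous_subtype_val x.2.2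
  · left
    have hG : #G < τ := by
      rw [← mk_range_eq p hpinj, ← Set.inter_union_sdiff (Set.range p) I]
      exact (mk_union_le _ _).trans_lt (add_lt_of_lt hτ.aleph0_le (not_le.1 hcard) hnd)
    have hall : RelLle ((⋃ x ∈ A, U x) ∪ ⋃ x ∈ G, U x) τ :=
      hW.union hτ.aleph0_le (RelLle.biUnion hτ hG fun x _ => hUrel x)
    intro S hS hcov
    obtain ⟨T, hTS, hT, hsub⟩ := hall S hS (hcov ▸ Set.subset_univ _)
    refine ⟨T, hTS, hT, Set.eq_univ_of_forall fun z => hsub ?_⟩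
    by_cases hz : z ∈ ⋃ x ∈ A, U x
    · exact Or.inl hz
    · obtain ⟨x, hx⟩ := Set.mem_iUnion.1 (hFV hz)
      exact Or.inr (Set.mem_biUnion (show x ∈ G from ⟨z, hz, hx⟩) (hVU x hx))
end

section
/- Let τ be an infinite regular cardinal, X a topological space with odL(X) ≤ τ, and D the set of isolated points of X. Then X − D (with the subspace topology) does not contain a subset of cardinality ≥ τ which is discrete and clopen in X − D. -/
universe u

open Cardinal

/-- If `A` is nonempty and closed with dense complement, and every singleton of `A` is cut out of
`A` by an open set, then `odL(X) ≤ κ` forces `#A < κ`. -/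
theorem OdLle.mk_lt_of_isClosed {X : Type u} [TopologicalSpace X] {κ : Cardinal.{u}}
    (hod : OdLle X κ) {A : Set X} (hne : A.Nonempty) (hcl : IsClosed A) (hdense : Dense Aᶜ)
    (hdisc : ∀ a ∈ A, ∃ U, IsOpen U ∧ U ∩ A = {a}) : #A < κ := by
  let V : A → Set X := fun a => (A \ {a.1})ᶜ
  have mem_V (a b : A) : a.1 ∈ V b ↔ a = b := by
    simp [V, Subtype.ext_iff]
  have hV : ∀ W ∈ Set.range V, IsOpen W ∧ Dense W := by
    rintro _ ⟨a, rfl⟩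
    refine ⟨?_, hdense.mono (Set.compl_subset_compl.2 Set.sdiff_subset)⟩
    obtain ⟨U, hU, hUA⟩ := hdisc a a.2
    have : V a = Aᶜ ∪ U := by
      ext x
      have := Set.ext_iff.1 hUA x
      simp only [Set.mem_inter_iff, Set.mem_singleton_iff] at this
      simp only [V, Set.mem_compl_iff, Set.mem_sdiff, Set.mem_singleton_iff, Set.mem_union]
      tauto
    rw [this]
    exact hcl.isOpen_compl.union hU
  have hcover : ⋃₀ Set.range V = Set.univ := by
    refine Set.eq_univ_of_forall fun x => ?_
    by_cases hx : x ∈ A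
    · exact ⟨V ⟨x, hx⟩, ⟨_, rfl⟩, (mem_V ⟨x, hx⟩ _).2 rfl⟩
    · obtain ⟨a, ha⟩ := hne
      exact ⟨V ⟨a, ha⟩, ⟨_, rfl⟩, fun h => hx h.1⟩
  obtain ⟨T, hTV, hT, hTcover⟩ := hod _ hV hcover
  have hVT (a : A) : V a ∈ T := by
    obtain ⟨W, hW, haW⟩ := Set.mem_sUnion.1 (hTcover ▸ Set.mem_univ a.1)
    obtain ⟨b, rfl⟩ := hTV hW
    rwa [(mem_V a b).1 haW]
  refine (mk_le_of_injective (f := fun a : A => (⟨V a, hVT a⟩ : T)) fun a b hab => ?_).trans_lt hT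
  have hab : V a = V b := congrArg Subtype.val hab
  exact (mem_V a b).1 (hab ▸ (mem_V a a).2 rfl)

theorem stmt_9 (X : Type u) [TopologicalSpace X]
    (τ : Cardinal.{u}) (hτ : τ.IsRegular) (hod : OdLle X τ) :
    ¬ ∃ E : Set ({x : X | ¬ IsOpen ({x} : Set X)} : Set X),
        IsClopen E ∧ DiscreteTopology E ∧ τ ≤ #E := by
  rintro ⟨E, hE, hdisc, hcard⟩
  have hclosed : IsClosed {x : X | ¬ IsOpen ({x} : Set X)} := by
    have : {x : X | ¬ IsOpen ({x} : Set X)}ᶜ = ⋃ x ∈ {x : X | IsOpen ({x} : Set X)}, {x} := by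
      ext; simp
    rw [← isOpen_compl_iff, this]
    exact isOpen_biUnion fun _ hx => hx
  have hsep : ∀ e ∈ E, ∃ U : Set X, IsOpen U ∧ Subtype.val ⁻¹' U = ({e} : Set _) := by
    intro e he
    have h : IsOpen (Subtype.val '' ({⟨e, he⟩} : Set E)) :=
      hE.isOpen.isOpenMap_subtype_val _ (isOpen_discrete _)
    rw [Set.image_singleton] at h
    exact isOpen_induced_iff.1 h
  have hne : E.Nonempty := by
    rw [← Set.nonempty_coe_sort, ← mk_ne_zero_iff]
    exact (hτ.pos.trans_le hcard).ne'
  refine (hod.mk_lt_of_isClosed (hne.image Subtype.val)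
    (hclosed.isClosedMap_subtype_val _ hE.isClosed) ?_ ?_).not_ge
    (hcard.trans_eq (mk_image_eq Subtype.val_injective).symm)
  · rw [← interior_eq_empty_iff_dense_compl, Set.eq_empty_iff_forall_notMem]
    rintro x hx
    obtain ⟨e, he, rfl⟩ := interior_subset hx
    obtain ⟨U, hU, hUe⟩ := hsep e he
    refine e.2 ?_
    convert (isOpen_interior (s := Subtype.val '' E)).inter hU using 1
    refine Set.Subset.antisymm (Set.singleton_subset_iff.2 ⟨hx, hUe.ge rfl⟩) ?_
    rintro y ⟨hy, hyU⟩
    obtain ⟨f, -, rfl⟩ := interior_subset hy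
    exact congrArg Subtype.val (hUe.le hyU)
  · rintro _ ⟨e, he, rfl⟩
    obtain ⟨U, hU, hUe⟩ := hsep e he
    refine ⟨U, hU, Set.Subset.antisymm ?_ (Set.singleton_subset_iff.2 ⟨hUe.ge rfl, e, he, rfl⟩)⟩
    rintro _ ⟨hyU, f, -, rfl⟩
    exact congrArg Subtype.val (hUe.le hyU)
end

section
/- Let τ be an infinite regular cardinal and X a T1 topological space such that every point of X has an open neighborhood U with L(U) ≤ τ, and such that odL(X) ≤ τ. Let D ⊆ X be the set of isolated points of X. Then L(X − D) ≤ τ (subspace topology). -/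
universe u

open Cardinal

/-- `A` is a `κ`-Lindelöf subset: every cover of `A` by open sets of the ambient space has a
subcover of cardinality `< κ`. -/
def LleOn {X : Type u} [TopologicalSpace X] (A : Set X) (κ : Cardinal.{u}) : Prop :=
  ∀ S : Set (Set X), (∀ U ∈ S, IsOpen U) → A ⊆ ⋃₀ S → ∃ T ⊆ S, #T < κ ∧ A ⊆ ⋃₀ T

section LleOn

variable {X : Type u} [TopologicalSpace X] {A F : Set X} {κ : Cardinal.{u}}

theorem Lle.lleOn (h : Lle A κ) : LleOn A κ := by
  intro S hS hA
  obtain ⟨T, hTS, hT, hcov⟩ := h ((fun U => Subtype.val ⁻¹' U) '' S)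
    (by rintro _ ⟨U, hU, rfl⟩; exact (hS U hU).preimage continuous_subtype_val)
    (by
      refine Set.eq_univ_of_forall fun x => ?_
      obtain ⟨U, hU, hx⟩ := hA x.2
      exact ⟨_, ⟨U, hU, rfl⟩, hx⟩)
  have hpre : ∀ V ∈ T, ∃ U ∈ S, Subtype.val ⁻¹' U = V := fun V hV => hTS hV
  choose! g hgS hg using hpre
  refine ⟨g '' T, by rintro _ ⟨V, hV, rfl⟩; exact hgS V hV, mk_image_le.trans_lt hT, fun x hx => ?_⟩
  obtain ⟨V, hV, hxV⟩ : (⟨x, hx⟩ : A) ∈ ⋃₀ T := hcov ▸ Set.mem_univ _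
  rw [← hg V hV] at hxV
  exact ⟨g V, ⟨V, hV, rfl⟩, hxV⟩

theorem LleOn.lle (h : LleOn A κ) : Lle A κ := by
  intro S hS hcov
  obtain ⟨T, hTS, hT, hA⟩ := h {W | IsOpen W ∧ (Subtype.val ⁻¹' W : Set A) ∈ S}
    (fun U hU => hU.1)
    (by
      intro x hx
      obtain ⟨V, hV, hxV⟩ : (⟨x, hx⟩ : A) ∈ ⋃₀ S := hcov ▸ Set.mem_univ _
      obtain ⟨W, hW, rfl⟩ := isOpen_induced_iff.1 (hS V hV)
      exact ⟨W, ⟨hW, hV⟩, hxV⟩)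
  refine ⟨(fun W => Subtype.val ⁻¹' W) '' T, ?_, mk_image_le.trans_lt hT,
    Set.eq_univ_of_forall fun x => ?_⟩
  · rintro _ ⟨W, hW, rfl⟩
    exact (hTS hW).2
  · obtain ⟨W, hW, hx⟩ := hA x.2
    exact ⟨_, ⟨W, hW, rfl⟩, hx⟩

theorem LleOn.of_isClosed_subset (h : LleOn A κ) (hF : IsClosed F) (hFA : F ⊆ A) :
    LleOn F κ := by
  intro S hS hcov
  obtain ⟨T, hTS, hT, hA⟩ := h (insert Fᶜ S)
    (by
      rintro U (rfl | hU)
      · exact hF.isOpen_compl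
      · exact hS U hU)
    (by
      intro x _
      by_cases hx : x ∈ F
      · obtain ⟨U, hU, hxU⟩ := hcov hx
        exact ⟨U, Or.inr hU, hxU⟩
      · exact ⟨Fᶜ, Or.inl rfl, hx⟩)
  refine ⟨T ∩ S, Set.inter_subset_right, (mk_le_mk_of_subset Set.inter_subset_left).trans_lt hT,
    fun x hx => ?_⟩
  obtain ⟨U, hU, hxU⟩ := hA (hFA hx)
  rcases hTS hU with rfl | hUS
  · exact absurd hx hxU
  · exact ⟨U, ⟨hU, hUS⟩, hxU⟩

theorem LleOn.sUnion {𝒜 : Set (Set X)} (hκ : κ.IsRegular) (hcard : #𝒜 < κ)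
    (h : ∀ A ∈ 𝒜, LleOn A κ) : LleOn (⋃₀ 𝒜) κ := by
  intro S hS hcov
  have key : ∀ A ∈ 𝒜, ∃ T ⊆ S, #T < κ ∧ A ⊆ ⋃₀ T := fun A hA =>
    h A hA S hS ((Set.subset_sUnion_of_mem hA).trans hcov)
  choose! T hTS hT hAT using key
  refine ⟨⋃ A ∈ 𝒜, T A, Set.iUnion₂_subset hTS,
    (card_biUnion_lt_iff_forall_of_isRegular hκ hcard).2 hT, ?_⟩
  rintro x ⟨A, hA, hx⟩
  obtain ⟨U, hU, hxU⟩ := hAT A hA hx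
  exact ⟨U, Set.mem_biUnion hA hU, hxU⟩

/-- Closed nowhere dense subsets of an od-`κ`-Lindelöf space are `κ`-Lindelöf. -/
theorem OdLle.lleOn_of_isClosed (h : OdLle X κ) (hκ : 0 < κ) (hF : IsClosed F)
    (hd : Dense Fᶜ) : LleOn F κ := by
  intro S hS hcov
  rcases F.eq_empty_or_nonempty with rfl | ⟨y, hy⟩
  · exact ⟨∅, Set.empty_subset _, by simpa using hκ, Set.empty_subset _⟩
  obtain ⟨T, hTS, hT, hA⟩ := h ((fun U => U ∪ Fᶜ) '' S)
    (by
      rintro _ ⟨U, hU, rfl⟩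
      exact ⟨(hS U hU).union hF.isOpen_compl, hd.mono Set.subset_union_right⟩)
    (by
      refine Set.eq_univ_of_forall fun x => ?_
      by_cases hx : x ∈ F
      · obtain ⟨U, hU, hxU⟩ := hcov hx
        exact ⟨_, ⟨U, hU, rfl⟩, Or.inl hxU⟩
      · obtain ⟨U, hU, -⟩ := hcov hy
        exact ⟨_, ⟨U, hU, rfl⟩, Or.inr hx⟩)
  have hpre : ∀ V ∈ T, ∃ U ∈ S, U ∪ Fᶜ = V := fun V hV => hTS hV
  choose! g hgS hg using hpre
  refine ⟨g '' T, by rintro _ ⟨V, hV, rfl⟩; exact hgS V hV, mk_image_le.trans_lt hT, fun x hx => ?_⟩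
  obtain ⟨V, hV, hxV⟩ : x ∈ ⋃₀ T := hA ▸ Set.mem_univ _
  rw [← hg V hV] at hxV
  exact ⟨g V, ⟨V, hV, rfl⟩, hxV.resolve_right fun hn => hn hx⟩

/-- If every point has an open neighbourhood satisfying the hereditary property `P`, then some
pairwise disjoint family of open sets satisfying `P` has dense union. -/
theorem exists_pairwiseDisjoint_isOpen_dense_sUnion {P : Set X → Prop}
    (hmono : ∀ U V, U ⊆ V → P V → P U) (hP : ∀ x, ∃ U, IsOpen U ∧ x ∈ U ∧ P U) :
    ∃ 𝒪 : Set (Set X), (∀ O ∈ 𝒪, IsOpen O ∧ P O) ∧ 𝒪.PairwiseDisjoint id ∧ Dense (⋃₀ 𝒪) := by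
  obtain ⟨𝒪, hmax⟩ := zorn_subset
    {𝒪 : Set (Set X) | (∀ O ∈ 𝒪, IsOpen O ∧ P O) ∧ 𝒪.PairwiseDisjoint id} (by
      intro c hc hchain
      refine ⟨⋃₀ c, ⟨?_, ?_⟩, fun s hs => Set.subset_sUnion_of_mem hs⟩
      · rintro O ⟨s, hs, hO⟩
        exact (hc hs).1 O hO
      · exact (Set.pairwiseDisjoint_sUnion hchain.directedOn).2 fun s hs => (hc hs).2)
  obtain ⟨hO, hdisj⟩ := hmax.prop
  refine ⟨𝒪, hO, hdisj, dense_iff_inter_open.2 fun G hG ⟨x, hx⟩ => ?_⟩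
  by_contra hne
  obtain ⟨U, hU, hxU, hPU⟩ := hP x
  have hGd : ∀ O ∈ 𝒪, ∀ y ∈ G, y ∉ O := fun O hO y hy hyO => hne ⟨y, hy, O, hO, hyO⟩
  have hmem : G ∩ U ∈ 𝒪 := by
    refine hmax.le_of_ge (y := insert (G ∩ U) 𝒪) ⟨?_, ?_⟩ (Set.subset_insert _ _)
      (Set.mem_insert _ _)
    · rintro O (rfl | h)
      · exact ⟨hG.inter hU, hmono _ _ Set.inter_subset_right hPU⟩
      · exact hO O h
    · refine hdisj.insert fun O h _ => Set.disjoint_left.2 fun y hy => hGd O h y hy.1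
  exact hGd _ hmem x hx ⟨hx, hxU⟩

end LleOn

theorem stmt_10 (X : Type u) [TopologicalSpace X] [T1Space X]
    (τ : Cardinal.{u}) (hτ : τ.IsRegular)
    (hloc : ∀ x : X, ∃ U : Set X, IsOpen U ∧ x ∈ U ∧ Lle U τ)
    (hod : OdLle X τ) :
    Lle ({x : X | ¬ IsOpen ({x} : Set X)} : Set X) τ := by
  have hτ0 : 0 < τ := aleph0_pos.trans_le hτ.aleph0_le
  set Y : Set X := {x : X | ¬ IsOpen ({x} : Set X)}
  have hYclosed : IsClosed Y := by
    rw [← isOpen_compl_iff, isOpen_iff_forall_mem_open]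
    intro x hx
    have hx' : IsOpen ({x} : Set X) := not_not.1 hx
    exact ⟨{x}, Set.singleton_subset_iff.2 hx, hx', rfl⟩
  obtain ⟨𝒪, hO, hdisj, hdense⟩ := exists_pairwiseDisjoint_isOpen_dense_sUnion
    (P := fun O : Set X => ∃ U, O ⊆ U ∧ LleOn U τ)
    (fun U V hUV ⟨W, hVW, hW⟩ => ⟨W, hUV.trans hVW, hW⟩)
    (fun x => by
      obtain ⟨U, hU, hxU, hL⟩ := hloc x
      exact ⟨U, hU, hxU, U, subset_rfl, hL.lleOn⟩)
  have hWopen : IsOpen (⋃₀ 𝒪) := isOpen_sUnion fun O h => (hO O h).1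
  obtain ⟨𝒱, h𝒱, h𝒱card, h𝒱cov⟩ := hod.lleOn_of_isClosed hτ0 hWopen.isClosed_compl
    (by rwa [compl_compl]) {U | IsOpen U ∧ LleOn U τ} (fun U hU => hU.1) (fun x _ => by
      obtain ⟨U, hU, hxU, hL⟩ := hloc x
      exact ⟨U, ⟨hU, hL.lleOn⟩, hxU⟩)
  set V := ⋃₀ 𝒱
  have hVopen : IsOpen V := isOpen_sUnion fun U h => (h𝒱 h).1
  have hVW : ∀ x, x ∉ V → ∃ O ∈ 𝒪, x ∈ O := fun x hx => by
    by_contra hn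
    exact hx (h𝒱cov fun ⟨O, h, hxO⟩ => hn ⟨O, h, hxO⟩)
  have huniq : ∀ O ∈ 𝒪, ∀ O' ∈ 𝒪, ∀ x, x ∈ O → x ∈ O' → O = O' := fun O h O' h' x hx hy =>
    hdisj.elim_set h h' x hx hy
  -- The members of `𝒪` having a non-isolated point outside `V`.
  let 𝒬 : Set (Set X) := {O ∈ 𝒪 | ∃ x ∈ O, x ∉ V ∧ x ∈ Y}
  have h𝒬card : #𝒬 < τ := by
    rcases 𝒬.eq_empty_or_nonempty with he | ⟨-, -, x₀, -⟩
    · simpa [he] using hτ0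
    have : Nonempty X := ⟨x₀⟩
    have hp : ∀ O ∈ 𝒬, ∃ x ∈ O, x ∉ V ∧ x ∈ Y := fun O h => h.2
    choose! p hpO hpV hpY using hp
    have hinter : ∀ O ∈ 𝒪, ∀ x ∈ O, x ∈ p '' 𝒬 → x = p O := by
      rintro O h _ hx ⟨O', h', rfl⟩
      rw [huniq O h O' h'.1 _ hx (hpO O' h')]
    have hEclosed : IsClosed (p '' 𝒬) := by
      rw [← isOpen_compl_iff, isOpen_iff_forall_mem_open]
      intro x hx
      by_cases hxV : x ∈ V
      · refine ⟨V, ?_, hVopen, hxV⟩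
        rintro _ hy ⟨O, h, rfl⟩
        exact hpV O h hy
      · obtain ⟨O, h, hxO⟩ := hVW x hxV
        by_cases hOP : O ∈ 𝒬
        · refine ⟨O \ {p O}, fun y hy hyE => hy.2 (hinter O h y hy.1 hyE),
            (hO O h).1.sdiff isClosed_singleton, hxO, ?_⟩
          rintro rfl
          exact hx ⟨O, hOP, rfl⟩
        · refine ⟨O, ?_, (hO O h).1, hxO⟩
          rintro _ hy ⟨O', h', rfl⟩
          exact hOP (huniq O h O' h'.1 _ hy (hpO O' h') ▸ h')
    have hEdense : Dense (p '' 𝒬)ᶜ := by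
      refine dense_iff_inter_open.2 fun G hG ⟨x, hx⟩ => ?_
      by_contra hne
      have hGE : ∀ y ∈ G, y ∈ p '' 𝒬 := fun y hy => by
        by_contra hn
        exact hne ⟨y, hy, hn⟩
      obtain ⟨O, h, rfl⟩ := hGE x hx
      refine hpY O h ?_
      have : G ∩ O = {p O} := Set.Subset.antisymm
        (fun y hy => hinter O h.1 y hy.2 (hGE y hy.1))
        (Set.singleton_subset_iff.2 ⟨hx, hpO O h⟩)
      exact this ▸ hG.inter (hO O h.1).1
    obtain ⟨T, hTP, hT, hcov⟩ := hod.lleOn_of_isClosed hτ0 hEclosed hEdense 𝒬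
      (fun O h => (hO O h.1).1) (by rintro _ ⟨O, h, rfl⟩; exact ⟨O, h, hpO O h⟩)
    refine (mk_le_mk_of_subset fun O h => ?_).trans_lt hT
    obtain ⟨O', h', hx⟩ := hcov ⟨O, h, rfl⟩
    exact huniq O h.1 O' (hTP h').1 _ (hpO O h) hx ▸ h'
  have hdiff : ∀ O ∈ 𝒪, IsClosed (O \ V) := fun O h => by
    rw [← isOpen_compl_iff, isOpen_iff_forall_mem_open]
    intro x hx
    by_cases hxV : x ∈ V
    · exact ⟨V, fun y hy hn => hn.2 hy, hVopen, hxV⟩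
    · obtain ⟨O', h', hxO'⟩ := hVW x hxV
      refine ⟨O', fun y hy hn => hx ⟨?_, hxV⟩, (hO O' h').1, hxO'⟩
      exact huniq O h O' h' y hn.1 hy ▸ hxO'
  have hunion : LleOn (⋃₀ (𝒱 ∪ (fun O => O \ V) '' 𝒬)) τ := by
    refine LleOn.sUnion hτ ((mk_union_le _ _).trans_lt
      (add_lt_of_lt hτ.aleph0_le h𝒱card (mk_image_le.trans_lt h𝒬card))) ?_
    rintro _ (h | ⟨O, h, rfl⟩)
    · exact (h𝒱 h).2
    · obtain ⟨U, hOU, hU⟩ := (hO O h.1).2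
      exact hU.of_isClosed_subset (hdiff O h.1) (Set.sdiff_subset.trans hOU)
  refine (hunion.of_isClosed_subset hYclosed fun x hx => ?_).lle
  by_cases hxV : x ∈ V
  · exact Set.sUnion_mono Set.subset_union_left hxV
  · obtain ⟨O, h, hxO⟩ := hVW x hxV
    exact ⟨O \ V, Or.inr ⟨O, ⟨h, x, hxO, hxV, hx⟩, rfl⟩, hxO, hxV⟩
end

section
/- Let κ be an infinite regular cardinal and X a T1 topological space with odL(X) ≤ κ. Then the subspace of non-isolated points of X satisfies ℓL ≤ κ, i.e. it is linearly Lindelöf_κ. -/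
universe u

open Cardinal

/-- In a `T1` space, if the points of `D` are not isolated and `D` is relatively discrete, then
the complement of the closure of `D` is dense. -/
theorem dense_compl_closure_of_discrete {X : Type u} [TopologicalSpace X] [T1Space X] {D : Set X}
    (hiso : ∀ x ∈ D, ¬ IsOpen ({x} : Set X))
    (hdisc : ∀ x ∈ D, ∃ O : Set X, IsOpen O ∧ x ∈ O ∧ ∀ y ∈ D, y ∈ O → y = x) :
    Dense (closure D)ᶜ := by
  rw [← interior_eq_empty_iff_dense_compl, Set.eq_empty_iff_forall_notMem]
  intro z hz
  obtain ⟨d, hdU, hdD⟩ :=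
    mem_closure_iff.1 (interior_subset hz) _ isOpen_interior hz
  obtain ⟨O, hO, hdO, hOD⟩ := hdisc d hdD
  have hsub : interior (closure D) ∩ O = {d} := by
    refine Set.Subset.antisymm (fun w hw => ?_) (Set.singleton_subset_iff.2 ⟨hdU, hdO⟩)
    have hw' : w ∈ closure (O ∩ D) := hO.inter_closure ⟨hw.2, interior_subset hw.1⟩
    have hle : O ∩ D ⊆ {d} := fun y hy => hOD y hy.2 hy.1
    simpa using closure_mono hle hw'
  exact hiso d hdD (hsub ▸ isOpen_interior.inter hO)

/-- A closed set with dense complement inherits the covering property: a nonempty family of open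
sets covering it has a subfamily of cardinality `< κ` covering it. -/
theorem OdLle.exists_subcover_of_dense_compl {X : Type u} [TopologicalSpace X] {κ : Cardinal.{u}}
    (hod : OdLle X κ) {N : Set X} (hN : IsClosed N) (hdense : Dense Nᶜ) {C : Set (Set X)}
    (hC : ∀ U ∈ C, IsOpen U) (hne : C.Nonempty) (hcov : N ⊆ ⋃₀ C) :
    ∃ T ⊆ C, #T < κ ∧ N ⊆ ⋃₀ T := by
  obtain ⟨T, hT, hTκ, hTcov⟩ := hod ((fun U => Nᶜ ∪ U) '' C)
    (by
      rintro _ ⟨U, hU, rfl⟩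
      exact ⟨hN.isOpen_compl.union (hC U hU), hdense.mono Set.subset_union_left⟩)
    (by
      refine Set.eq_univ_of_forall fun x => ?_
      by_cases hx : x ∈ N
      · obtain ⟨U, hU, hxU⟩ := hcov hx
        exact ⟨_, ⟨U, hU, rfl⟩, Or.inr hxU⟩
      · obtain ⟨U, hU⟩ := hne
        exact ⟨_, ⟨U, hU, rfl⟩, Or.inl hx⟩)
  have hpre : ∀ V ∈ T, ∃ U ∈ C, Nᶜ ∪ U = V := fun V hV => hT hV
  choose! g hgC hg using hpre
  refine ⟨g '' T, by rintro _ ⟨V, hV, rfl⟩; exact hgC V hV, mk_image_le.trans_lt hTκ, ?_⟩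
  intro x hx
  obtain ⟨V, hV, hxV⟩ : x ∈ ⋃₀ T := hTcov ▸ Set.mem_univ x
  rw [← hg V hV] at hxV
  exact ⟨g V, ⟨V, hV, rfl⟩, hxV.resolve_left fun h => h hx⟩

/-- A subfamily of a chain cover that does not cover is bounded above in the chain. -/
theorem IsChain.exists_forall_subset_of_not_cover {X : Type u} {C T : Set (Set X)}
    (hchain : IsChain (· ⊆ ·) C) (hcov : ⋃₀ C = Set.univ) (hT : T ⊆ C)
    (hTcov : ⋃₀ T ≠ Set.univ) : ∃ V ∈ C, ∀ U ∈ T, U ⊆ V := by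
  obtain ⟨p, hp⟩ := (Set.ne_univ_iff_exists_notMem _).1 hTcov
  obtain ⟨V, hV, hpV⟩ : p ∈ ⋃₀ C := hcov ▸ Set.mem_univ p
  refine ⟨V, hV, fun U hU => (hchain.total (hT hU) hV).resolve_right fun h => ?_⟩
  exact hp ⟨U, hU, h hpV⟩

/-- Along a well-order, values can be chosen recursively subject to a condition involving the set
of earlier values, provided the condition can be met for every set of smaller cardinality. -/
theorem exists_forall_image_Iio {ι X : Type u} [LinearOrder ι] [WellFoundedLT ι]
    (P : ι → Set X → X → Prop)
    (hP : ∀ i (A : Set X), #A ≤ #(Set.Iio i) → ∃ x, P i A x) :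
    ∃ f : ι → X, ∀ i, P i (f '' Set.Iio i) (f i) := by
  choose F hF using hP
  let step : ∀ i : ι, (∀ j, j < i → X) → X := fun i ih =>
    F i (Set.range fun j : Set.Iio i => ih j.1 j.2) mk_range_le
  let f : ι → X := (wellFounded_lt (α := ι)).fix step
  refine ⟨f, fun i => ?_⟩
  have hfi : f i = F i (f '' Set.Iio i) mk_image_le := by
    simp only [Set.image_eq_range]
    exact WellFounded.fix_eq _ step i
  rw [hfi]
  exact hF i _ _

/-- A chain of open sets covering a `T1` space with `odL ≤ κ`, all of whose members contain every
isolated point, has a subcover of cardinality `< κ`. -/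
theorem OdLle.exists_subcover_of_isChain {X : Type u} [TopologicalSpace X] [T1Space X]
    {κ : Cardinal.{u}} (hod : OdLle X κ) {C : Set (Set X)} (hne : C.Nonempty)
    (hC : ∀ U ∈ C, IsOpen U) (hchain : IsChain (· ⊆ ·) C) (hcov : ⋃₀ C = Set.univ)
    (hiso : ∀ U ∈ C, ∀ x : X, IsOpen ({x} : Set X) → x ∈ U) :
    ∃ T ⊆ C, #T < κ ∧ ⋃₀ T = Set.univ := by
  by_cases hdense : ∃ U ∈ C, Dense U
  · obtain ⟨U, hU, hUd⟩ := hdense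
    obtain ⟨T, hT, hTκ, hTcov⟩ := hod {V ∈ C | U ⊆ V}
      (fun V hV => ⟨hC V hV.1, hUd.mono hV.2⟩)
      (by
        refine Set.eq_univ_of_forall fun x => ?_
        obtain ⟨V, hV, hxV⟩ : x ∈ ⋃₀ C := hcov ▸ Set.mem_univ x
        rcases hchain.total hU hV with h | h
        · exact ⟨V, ⟨hV, h⟩, hxV⟩
        · exact ⟨U, ⟨hU, subset_rfl⟩, h hxV⟩)
    exact ⟨T, fun V hV => (hT hV).1, hTκ, hTcov⟩
  push Not at hdense
  obtain ⟨W, ⟨hWC, hWcov⟩, hWmin⟩ :=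
    (InvImage.wf (fun T : Set (Set X) => #T) Cardinal.lt_wf).has_min
      {T | T ⊆ C ∧ ⋃₀ T = Set.univ} ⟨C, subset_rfl, hcov⟩
  by_contra hcon
  have hκW : κ ≤ #W := not_lt.1 fun h => hcon ⟨W, hWC, h, hWcov⟩
  have hbdd : ∀ T ⊆ C, #T < #W → ∃ V ∈ C, ∀ U ∈ T, U ⊆ V := fun T hT hTW =>
    hchain.exists_forall_subset_of_not_cover hcov hT fun h => hWmin T ⟨hT, h⟩ hTW
  have hmem : ∀ x : X, ∃ U ∈ C, x ∈ U := fun x => by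
    have : x ∈ ⋃₀ C := hcov ▸ Set.mem_univ x
    exact this
  choose G hGC hG using hmem
  obtain ⟨_, _, hord⟩ := exists_ord_eq_type_lt W
  -- Each new point avoids the closure of a member of the chain absorbing the earlier points.
  obtain ⟨f, hf⟩ := exists_forall_image_Iio (ι := W)
    (fun i A x => ∃ U ∈ C, (i : Set X) ⊆ U ∧ (∀ a ∈ A, G a ⊆ U) ∧ x ∉ closure U)
    (by
      intro i A hA
      obtain ⟨V, hV, hAV⟩ := hbdd (G '' A) (by rintro _ ⟨a, -, rfl⟩; exact hGC a)
        ((mk_image_le.trans hA).trans_lt (mk_Iio_lt i hord))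
      obtain ⟨U, hU, hVU, hiU⟩ : ∃ U ∈ C, V ⊆ U ∧ (i : Set X) ⊆ U := by
        rcases hchain.total hV (hWC i.2) with h | h
        · exact ⟨_, hWC i.2, h, subset_rfl⟩
        · exact ⟨V, hV, subset_rfl, h⟩
      obtain ⟨x, hx⟩ := not_forall.1 (hdense U hU)
      exact ⟨x, U, hU, hiU, fun a ha => (hAV _ ⟨a, ha, rfl⟩).trans hVU, hx⟩)
  choose U hUC hWU hGU hfU using hf
  have hND : Dense (closure (Set.range f))ᶜ := by
    refine dense_compl_closure_of_discrete ?_ ?_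
    · rintro _ ⟨i, rfl⟩ hi
      exact hfU i (subset_closure (hiso _ (hUC i) _ hi))
    · rintro _ ⟨i, rfl⟩
      refine ⟨G (f i) ∩ (closure (U i))ᶜ, (hC _ (hGC _)).inter isClosed_closure.isOpen_compl,
        ⟨hG _, hfU i⟩, ?_⟩
      rintro _ ⟨j, rfl⟩ ⟨hj, hj'⟩
      rcases lt_trichotomy i j with hij | rfl | hij
      · exact absurd (subset_closure (hGU j _ ⟨i, hij, rfl⟩ hj)) (hfU j)
      · rfl
      · exact absurd (subset_closure (hGU i _ ⟨j, hij, rfl⟩ (hG _))) hj'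
  obtain ⟨T, hTC, hTκ, hTcov⟩ := hod.exists_subcover_of_dense_compl isClosed_closure hND hC hne
    (hcov ▸ Set.subset_univ _)
  obtain ⟨V, hV, hTV⟩ := hbdd T hTC (hTκ.trans_le hκW)
  have hfV : ∀ i, f i ∈ V := fun i => by
    obtain ⟨O, hO, hfO⟩ := hTcov (subset_closure ⟨i, rfl⟩)
    exact hTV O hO hfO
  refine hdense V hV ?_
  suffices V = Set.univ from this ▸ dense_univ
  refine Set.eq_univ_of_forall fun x => ?_
  obtain ⟨O, hO, hxO⟩ : x ∈ ⋃₀ W := hWcov ▸ Set.mem_univ x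
  rcases hchain.total (hWC hO) hV with h | h
  · exact h hxO
  · exact absurd (subset_closure (hWU ⟨O, hO⟩ (h (hfV _)))) (hfU _)

theorem stmt_12 (X : Type u) [TopologicalSpace X] [T1Space X]
    (κ : Cardinal.{u}) (hκ : κ.IsRegular) (hod : OdLle X κ) :
    LinLle ({x : X | ¬ IsOpen ({x} : Set X)} : Set X) κ := by
  set Y : Set X := {x : X | ¬ IsOpen ({x} : Set X)}
  intro S hS hchain hcov
  rcases S.eq_empty_or_nonempty with rfl | hne
  · exact ⟨∅, subset_rfl, by simpa using hκ.pos, hcov⟩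
  let E : Set Y → Set X := fun U => Subtype.val '' U ∪ Yᶜ
  have hEmem : ∀ (U : Set Y) (y : Y), (y : X) ∈ E U ↔ y ∈ U := fun U y => by simp [E]
  have hYo : IsOpen Yᶜ := by
    rw [isOpen_iff_mem_nhds]
    intro x hx
    have hx' : IsOpen ({x} : Set X) := not_not.1 hx
    exact Filter.mem_of_superset (hx'.mem_nhds rfl) (Set.singleton_subset_iff.2 hx)
  obtain ⟨T, hT, hTκ, hTcov⟩ := hod.exists_subcover_of_isChain (C := E '' S) (hne.image E)
    (by
      rintro _ ⟨U, hU, rfl⟩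
      obtain ⟨V, hV, rfl⟩ := isOpen_induced_iff.1 (hS U hU)
      have : E (Subtype.val ⁻¹' V) = V ∪ Yᶜ := by
        ext x
        by_cases hx : x ∈ Y <;> simp [E, hx]
      exact this ▸ hV.union hYo)
    (hchain.image_of_map_rel _ _ E fun _ _ h =>
      Set.union_subset_union_left _ (Set.image_mono h))
    (by
      refine Set.eq_univ_of_forall fun x => ?_
      by_cases hx : x ∈ Y
      · obtain ⟨U, hU, hxU⟩ : (⟨x, hx⟩ : Y) ∈ ⋃₀ S := hcov ▸ Set.mem_univ _
        exact ⟨_, ⟨U, hU, rfl⟩, (hEmem U ⟨x, hx⟩).2 hxU⟩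
      · obtain ⟨U, hU⟩ := hne
        exact ⟨_, ⟨U, hU, rfl⟩, Or.inr hx⟩)
    (by
      rintro _ ⟨U, -, rfl⟩ x hx
      exact Or.inr (not_not.2 hx))
  have hpre : ∀ V ∈ T, ∃ U ∈ S, E U = V := fun V hV => hT hV
  choose! g hgS hg using hpre
  refine ⟨g '' T, by rintro _ ⟨V, hV, rfl⟩; exact hgS V hV, mk_image_le.trans_lt hTκ, ?_⟩
  refine Set.eq_univ_of_forall fun y => ?_
  obtain ⟨V, hV, hyV⟩ : (y : X) ∈ ⋃₀ T := hTcov ▸ Set.mem_univ _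
  rw [← hg V hV] at hyV
  exact ⟨g V, ⟨V, hV, rfl⟩, (hEmem _ y).1 hyV⟩
end

section
/- Let κ be an infinite regular cardinal and X a topological space whose subspace of non-isolated points satisfies L ≤ κ (i.e. is Lindelöf_κ). Then odL(X) ≤ κ. -/
universe u

open Cardinal

/-- A dense set contains every isolated point. -/
theorem Dense.mem_of_isOpen_singleton {X : Type*} [TopologicalSpace X] {U : Set X}
    (hU : Dense U) {x : X} (hx : IsOpen ({x} : Set X)) : x ∈ U := by
  obtain ⟨y, hy, hyU⟩ := hU.inter_open_nonempty {x} hx (Set.singleton_nonempty x)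
  exact Set.mem_singleton_iff.mp hy ▸ hyU

/-- If a subspace satisfies `Lle`, then every family of open sets of the ambient space that covers
it has a subfamily of cardinality `< κ` that covers it. -/
theorem Lle.exists_subset_sUnion {X : Type u} [TopologicalSpace X] {κ : Cardinal.{u}} {A : Set X}
    (hA : Lle A κ) {S : Set (Set X)} (hS : ∀ U ∈ S, IsOpen U) (hcov : A ⊆ ⋃₀ S) :
    ∃ T ⊆ S, #T < κ ∧ A ⊆ ⋃₀ T := by
  obtain ⟨T, hTS, hTκ, hT⟩ := hA ((fun U : Set X => (Subtype.val ⁻¹' U : Set A)) '' S)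
    (by
      rintro _ ⟨U, hU, rfl⟩
      exact (hS U hU).preimage continuous_subtype_val)
    (by
      refine Set.eq_univ_of_forall fun x => ?_
      obtain ⟨U, hU, hx⟩ := hcov x.2
      exact ⟨_, ⟨U, hU, rfl⟩, hx⟩)
  choose g hgS hg using fun V : T => hTS V.2
  refine ⟨Set.range g, Set.range_subset_iff.mpr hgS, mk_range_le.trans_lt hTκ, fun x hx => ?_⟩
  obtain ⟨V, hV, hxV⟩ : (⟨x, hx⟩ : A) ∈ ⋃₀ T := hT ▸ Set.mem_univ _
  refine ⟨g ⟨V, hV⟩, Set.mem_range_self _, ?_⟩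
  exact (hg ⟨V, hV⟩).ge hxV

theorem stmt_13 (X : Type u) [TopologicalSpace X]
    (κ : Cardinal.{u}) (hκ : κ.IsRegular)
    (hL : Lle ({x : X | ¬ IsOpen ({x} : Set X)} : Set X) κ) :
    OdLle X κ := by
  intro S hS hcov
  obtain ⟨T, hTS, hTκ, hT⟩ :=
    hL.exists_subset_sUnion (fun U hU => (hS U hU).1) (hcov ▸ Set.subset_univ _)
  rcases S.eq_empty_or_nonempty with rfl | ⟨U, hU⟩
  · exact ⟨T, hTS, hTκ, Set.subset_empty_iff.mp hTS ▸ hcov⟩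
  refine ⟨insert U T, Set.insert_subset hU hTS, ?_, Set.eq_univ_of_forall fun x => ?_⟩
  · exact mk_insert_le.trans_lt
      (add_lt_of_lt hκ.aleph0_le hTκ (one_lt_aleph0.trans_le hκ.aleph0_le))
  · by_cases hx : IsOpen ({x} : Set X)
    · exact ⟨U, Set.mem_insert U T, (hS U hU).2.mem_of_isOpen_singleton hx⟩
    · exact Set.sUnion_subset_sUnion (Set.subset_insert U T) (hT hx)
end

section
/- A T1 topological space X is od-compact (every cover of X by dense open sets has a finite subcover) if and only if the subspace of non-isolated points of X is compact. -/
universe u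

open Cardinal

/-- In an od-compact space, closed nowhere dense sets are compact. -/
theorem OdCompact.isCompact_of_interior_eq_empty {X : Type u} [TopologicalSpace X]
    (h : OdCompact X) {F : Set X} (hF : IsClosed F) (hint : interior F = ∅) : IsCompact F := by
  refine isCompact_of_finite_subcover fun {ι} U hU hcov => ?_
  rcases F.eq_empty_or_nonempty with rfl | ⟨x₀, hx₀⟩
  · exact ⟨∅, Set.empty_subset _⟩
  have hFd : Dense Fᶜ := interior_eq_empty_iff_dense_compl.1 hint
  obtain ⟨T, hTS, hT, hTcov⟩ := h (Set.range fun i => U i ∪ Fᶜ)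
    (by
      rintro _ ⟨i, rfl⟩
      exact ⟨(hU i).union hF.isOpen_compl, hFd.mono Set.subset_union_right⟩)
    (by
      obtain ⟨i₀, -⟩ := Set.mem_iUnion.1 (hcov hx₀)
      refine Set.eq_univ_of_forall fun x => ?_
      by_cases hx : x ∈ F
      · obtain ⟨i, hi⟩ := Set.mem_iUnion.1 (hcov hx)
        exact ⟨_, ⟨i, rfl⟩, Or.inl hi⟩
      · exact ⟨_, ⟨i₀, rfl⟩, Or.inr hx⟩)
  classical
  lift T to Finset (Set X) using hT
  obtain ⟨t, -, rfl⟩ := Finset.subset_set_image_iff.1 (Set.image_univ.symm ▸ hTS)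
  refine ⟨t, fun x hx => ?_⟩
  obtain ⟨V, hV, hxi⟩ := hTcov.ge (Set.mem_univ x)
  obtain ⟨i, hi, rfl⟩ := Finset.mem_image.1 hV
  exact Set.mem_biUnion hi (hxi.resolve_right fun h => h hx)

/-- Every open cover admits a disjoint family of open sets refining it with dense union. -/
theorem exists_pairwiseDisjoint_refinement_dense {X ι : Type*} [TopologicalSpace X]
    (U : ι → Set X) (hU : ∀ i, IsOpen (U i)) (hcov : ⋃ i, U i = Set.univ) :
    ∃ P : Set (Set X), (∀ V ∈ P, IsOpen V ∧ ∃ i, V ⊆ U i) ∧ P.PairwiseDisjoint id ∧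
      Dense (⋃₀ P) := by
  obtain ⟨P, hP⟩ := zorn_subset
    {P : Set (Set X) | (∀ V ∈ P, IsOpen V ∧ ∃ i, V ⊆ U i) ∧ P.PairwiseDisjoint id} (by
      intro c hc hchain
      refine ⟨⋃₀ c, ⟨?_, ?_⟩, fun s hs => Set.subset_sUnion_of_mem hs⟩
      · rintro V ⟨s, hs, hV⟩
        exact (hc hs).1 V hV
      · exact (Set.pairwiseDisjoint_sUnion hchain.directedOn).2 fun s hs => (hc hs).2)
  refine ⟨P, hP.prop.1, hP.prop.2, dense_iff_inter_open.2 fun O hO ⟨x, hx⟩ => ?_⟩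
  by_contra hne
  rw [Set.not_nonempty_iff_eq_empty] at hne
  obtain ⟨i, hi⟩ := Set.mem_iUnion.1 (hcov.ge (Set.mem_univ x))
  have hins : insert (O ∩ U i) P ⊆ P := by
    refine hP.le_of_ge ⟨?_, ?_⟩ (Set.subset_insert _ _)
    · rintro V (rfl | hV)
      · exact ⟨hO.inter (hU i), i, Set.inter_subset_right⟩
      · exact hP.prop.1 V hV
    · refine hP.prop.2.insert fun V hV _ => Set.disjoint_left.2 fun y hy hyV => ?_
      exact hne.le ⟨hy.1, V, hV, hyV⟩
  exact hne.le ⟨hx, _, hins (Set.mem_insert _ _), hx, hi⟩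

theorem isClosed_setOf_not_isOpen_singleton (X : Type*) [TopologicalSpace X] :
    IsClosed {x : X | ¬ IsOpen ({x} : Set X)} := by
  refine ⟨isOpen_iff_forall_mem_open.2 fun x hx => ?_⟩
  have hx' : IsOpen ({x} : Set X) := not_not.1 hx
  exact ⟨{x}, Set.singleton_subset_iff.2 hx, hx', rfl⟩

/-- In an od-compact T1 space, if a closed set is covered by disjoint open sets, then only
finitely many of them contain non-isolated points of the closed set. -/
theorem OdCompact.finite_of_pairwiseDisjoint {X : Type u} [TopologicalSpace X] [T1Space X]
    (h : OdCompact X) {P : Set (Set X)} (hP : ∀ V ∈ P, IsOpen V) (hd : P.PairwiseDisjoint id)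
    {C : Set X} (hC : IsClosed C) (hCP : C ⊆ ⋃₀ P) :
    {V ∈ P | (V ∩ (C ∩ {x : X | ¬ IsOpen ({x} : Set X)})).Nonempty}.Finite := by
  rcases isEmpty_or_nonempty X with hX | hX
  · exact Set.toFinite _
  set A := {V ∈ P | (V ∩ (C ∩ {x : X | ¬ IsOpen ({x} : Set X)})).Nonempty}
  choose! d hd₁ using fun V (hV : V ∈ A) => hV.2
  have huniq : ∀ V ∈ P, ∀ W ∈ A, d W ∈ V → W = V := fun V hV W hW hdW =>
    hd.elim hW.1 hV (Set.not_disjoint_iff.2 ⟨d W, (hd₁ W hW).1, hdW⟩)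
  have hclosed : IsClosed (d '' A) := by
    refine ⟨isOpen_iff_forall_mem_open.2 fun x hx => ?_⟩
    by_cases hxC : x ∈ C
    · obtain ⟨V, hV, hxV⟩ := hCP hxC
      by_cases hVA : V ∈ A
      · refine ⟨V \ {d V}, ?_, (hP V hV).sdiff isClosed_singleton, hxV, ?_⟩
        · rintro y ⟨hyV, hy⟩ ⟨W, hW, rfl⟩
          exact hy (by rw [huniq V hV W hW hyV]; rfl)
        · rintro rfl
          exact hx ⟨V, hVA, rfl⟩
      · refine ⟨V, ?_, hP V hV, hxV⟩
        rintro y hyV ⟨W, hW, rfl⟩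
        exact hVA (huniq V hV W hW hyV ▸ hW)
    · refine ⟨Cᶜ, ?_, hC.isOpen_compl, hxC⟩
      rintro y hy ⟨W, hW, rfl⟩
      exact hy (hd₁ W hW).2.1
  have hint : interior (d '' A) = ∅ := by
    refine Set.eq_empty_of_forall_notMem fun x hx => ?_
    obtain ⟨V, hV, rfl⟩ := interior_subset hx
    refine (hd₁ V hV).2.2 ?_
    have : ({d V} : Set X) = interior (d '' A) ∩ V := by
      refine Set.Subset.antisymm (Set.singleton_subset_iff.2 ⟨hx, (hd₁ V hV).1⟩) ?_
      rintro y ⟨hy, hyV⟩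
      obtain ⟨W, hW, rfl⟩ := interior_subset hy
      rw [huniq V hV.1 W hW hyV]
      rfl
    rw [this]
    exact isOpen_interior.inter (hP V hV.1)
  obtain ⟨T, hTA, hT, hTcov⟩ :=
    (h.isCompact_of_interior_eq_empty hclosed hint).elim_finite_subcover_image
      (b := A) (c := id) (fun V hV => hP V hV.1) (by
        rintro _ ⟨V, hV, rfl⟩
        exact Set.mem_biUnion hV (hd₁ V hV).1)
  refine hT.subset fun V hV => ?_
  obtain ⟨W, hW, hVW⟩ := Set.mem_iUnion₂.1 (hTcov ⟨V, hV, rfl⟩)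
  rwa [huniq W (hTA hW).1 V hV hVW]

/-- Every open cover of an od-compact T1 space has a finite subfamily covering the
non-isolated points. -/
theorem OdCompact.exists_finset_cover {X : Type u} [TopologicalSpace X] [T1Space X]
    (h : OdCompact X) {ι : Type*} (U : ι → Set X) (hU : ∀ i, IsOpen (U i))
    (hcov : ⋃ i, U i = Set.univ) :
    ∃ t : Finset ι, {x : X | ¬ IsOpen ({x} : Set X)} ⊆ ⋃ i ∈ t, U i := by
  classical
  rcases isEmpty_or_nonempty ι with hι | hι
  · exact ⟨∅, (Set.subset_univ _).trans (by simp [← hcov])⟩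
  obtain ⟨P, hP, hd, hdense⟩ := exists_pairwiseDisjoint_refinement_dense U hU hcov
  have hPo : IsOpen (⋃₀ P) := isOpen_sUnion fun V hV => (hP V hV).1
  obtain ⟨t, ht⟩ := (h.isCompact_of_interior_eq_empty hPo.isClosed_compl
    (by rwa [interior_eq_empty_iff_dense_compl, compl_compl])).elim_finite_subcover U hU
    (hcov.ge.trans' (Set.subset_univ _))
  have hfin := h.finite_of_pairwiseDisjoint (fun V hV => (hP V hV).1) hd
    (isOpen_biUnion fun i (_ : i ∈ t) => hU i).isClosed_compl (Set.compl_subset_comm.1 ht)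
  choose! f hf using fun V hV => (hP V hV).2
  refine ⟨t ∪ hfin.toFinset.image f, fun x hx => ?_⟩
  by_cases hxt : x ∈ ⋃ i ∈ t, U i
  · exact Set.biUnion_subset_biUnion_left (fun i hi => Finset.mem_union_left _ hi) hxt
  · obtain ⟨V, hV, hxV⟩ := Set.compl_subset_comm.1 ht hxt
    refine Set.mem_biUnion (x := f V) ?_ (hf V hV hxV)
    exact Finset.mem_union_right _ (Finset.mem_image_of_mem _
      (hfin.mem_toFinset.2 ⟨hV, x, hxV, hxt, hx⟩))

theorem stmt_14 (X : Type u) [TopologicalSpace X] [T1Space X] :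
    OdCompact X ↔ CompactSpace ({x : X | ¬ IsOpen ({x} : Set X)} : Set X) := by
  have hN := isClosed_setOf_not_isOpen_singleton X
  rw [← isCompact_iff_compactSpace]
  constructor
  · intro h
    refine isCompact_of_finite_subcover fun {ι} U hU hcov => ?_
    rcases {x : X | ¬ IsOpen ({x} : Set X)}.eq_empty_or_nonempty with hE | ⟨x₀, hx₀⟩
    · exact ⟨∅, by simp [hE]⟩
    obtain ⟨i₀, -⟩ := Set.mem_iUnion.1 (hcov hx₀)
    obtain ⟨t, ht⟩ := h.exists_finset_cover
      (fun i => U i ∪ {x : X | ¬ IsOpen ({x} : Set X)}ᶜ)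
      (fun i => (hU i).union hN.isOpen_compl) (by
        refine Set.eq_univ_of_forall fun x => ?_
        by_cases hx : x ∈ {x : X | ¬ IsOpen ({x} : Set X)}
        · obtain ⟨i, hi⟩ := Set.mem_iUnion.1 (hcov hx)
          exact Set.mem_iUnion.2 ⟨i, Or.inl hi⟩
        · exact Set.mem_iUnion.2 ⟨i₀, Or.inr hx⟩)
    refine ⟨t, fun x hx => ?_⟩
    obtain ⟨i, hi, hxi⟩ := Set.mem_iUnion₂.1 (ht hx)
    exact Set.mem_biUnion hi (hxi.resolve_right fun h => h hx)
  · intro hK S hS hcov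
    rcases S.eq_empty_or_nonempty with rfl | ⟨U₀, hU₀⟩
    · exact ⟨∅, subset_rfl, Set.finite_empty, hcov⟩
    obtain ⟨T, hTS, hT, hTcov⟩ := hK.elim_finite_subcover_image (b := S) (c := id)
      (fun U hU => (hS U hU).1)
      (by simp [← Set.sUnion_eq_biUnion, hcov])
    refine ⟨insert U₀ T, Set.insert_subset hU₀ hTS, hT.insert _,
      Set.eq_univ_of_forall fun x => ?_⟩
    by_cases hx : IsOpen ({x} : Set X)
    · obtain ⟨y, rfl, hy⟩ := (hS U₀ hU₀).2.inter_open_nonempty _ hx (Set.singleton_nonempty x)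
      exact ⟨U₀, Set.mem_insert _ _, hy⟩
    · obtain ⟨U, hU, hxU⟩ := Set.mem_iUnion₂.1 (hTcov hx)
      exact ⟨U, Set.mem_insert_of_mem _ hU, hxU⟩
end

section
/- Let X and Y be topological spaces, κ an infinite cardinal, and f : X → Y a continuous open surjective map. If odL(X) ≤ κ, then odL(Y) ≤ κ. -/
universe u

open Cardinal

theorem stmt_16 (X Y : Type u) [TopologicalSpace X] [TopologicalSpace Y]
    (κ : Cardinal.{u}) (hκ : ℵ₀ ≤ κ)
    (f : X → Y) (hf : Continuous f) (hopen : IsOpenMap f)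
    (hsurj : Function.Surjective f) (hod : OdLle X κ) :
    OdLle Y κ := by
  intro S hS hcov
  obtain ⟨T, hTS, hT, hTcov⟩ := hod (Set.preimage f '' S)
    (by
      rintro _ ⟨U, hU, rfl⟩
      exact ⟨(hS U hU).1.preimage hf, (hS U hU).2.preimage hopen⟩)
    (by rw [Set.sUnion_image, ← Set.preimage_sUnion, hcov, Set.preimage_univ])
  refine ⟨Set.image f '' T, ?_, mk_image_le.trans_lt hT, ?_⟩
  · rintro _ ⟨V, hV, rfl⟩
    obtain ⟨U, hU, rfl⟩ := hTS hV
    rwa [Set.image_preimage_eq U hsurj]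
  · rw [← Set.image_sUnion, hTcov, Set.image_univ, hsurj.range_eq]
end

section
/- Let X be a topological space and κ an infinite regular cardinal. Then every subset B ⊆ X of regular cardinality ≥ κ has a complete accumulation point if and only if ℓL(X) ≤ κ, i.e. every open cover of X that is a chain under inclusion has a subcover of cardinality < κ. -/
universe u

open Cardinal

/-- In a chain cover `S`, a set of points escaping every member of some subcover yields a subcover
of at most its own cardinality. -/
theorem exists_subcover_mk_le {X : Type u} {S T : Set (Set X)} (hS : IsChain (· ⊆ ·) S)
    (hSX : ⋃₀ S = Set.univ) (hTS : T ⊆ S) (hTX : ⋃₀ T = Set.univ) {B : Set X}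
    (hB : ∀ U ∈ T, ∃ b ∈ B, b ∉ U) :
    ∃ T' ⊆ S, #T' ≤ #B ∧ ⋃₀ T' = Set.univ := by
  have h : ∀ x : X, ∃ W ∈ S, x ∈ W := fun x => by
    rw [← Set.mem_sUnion, hSX]
    trivial
  choose W hWS hW using h
  refine ⟨W '' B, ?_, mk_image_le, ?_⟩
  · rintro _ ⟨b, -, rfl⟩
    exact hWS b
  · refine Set.eq_univ_of_forall fun x => ?_
    obtain ⟨U, hU, hxU⟩ : x ∈ ⋃₀ T := hTX ▸ Set.mem_univ x
    obtain ⟨b, hbB, hbU⟩ := hB U hU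
    refine ⟨W b, ⟨b, hbB, rfl⟩, ?_⟩
    rcases hS.total (hTS hU) (hWS b) with hUW | hWU
    · exact hUW hxU
    · exact absurd (hWU (hW b)) hbU

/-- A cover `S` has a subcover of least cardinality. -/
theorem exists_subcover_mk_min {X : Type u} {S : Set (Set X)} (hSX : ⋃₀ S = Set.univ) :
    ∃ T ⊆ S, ⋃₀ T = Set.univ ∧ ∀ T' ⊆ S, ⋃₀ T' = Set.univ → #T ≤ #T' := by
  obtain ⟨T, ⟨hTS, hTX⟩, hT⟩ := exists_minimalFor_of_wellFoundedLT
    (fun T : Set (Set X) => T ⊆ S ∧ ⋃₀ T = Set.univ) (fun T => #T) ⟨S, subset_rfl, hSX⟩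
  exact ⟨T, hTS, hTX, fun T' hS' hX' => (le_total _ _).elim id (hT ⟨hS', hX'⟩)⟩

theorem mk_Iic_toType_ord_lt {c : Cardinal.{u}} (hc : ℵ₀ ≤ c) (a : c.ord.ToType) :
    #(Set.Iic a) < c := by
  rw [← Set.Iio_insert]
  exact mk_insert_le.trans_lt
    (add_lt_of_lt hc (by simpa using mk_Iio_lt a (by simp)) (one_lt_aleph0.trans_le hc))

/-- If every set of regular cardinality at least `κ` has a complete accumulation point, then every
open chain cover has a subcover of cardinality less than `κ`. -/
theorem linLle_of_forall_exists_completeAccPt {X : Type u} [TopologicalSpace X] {κ : Cardinal.{u}}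
    (hκ : ℵ₀ ≤ κ)
    (h : ∀ B : Set X, (#B).IsRegular → κ ≤ #B →
      ∃ x : X, ∀ U : Set X, IsOpen U → x ∈ U → #(U ∩ B : Set X) = #B) :
    LinLle X κ := by
  intro S hSo hSc hSX
  obtain ⟨T, hTS, hTX, hmin⟩ := exists_subcover_mk_min hSX
  refine ⟨T, hTS, ?_, hTX⟩
  by_contra! hκT
  have hT : ℵ₀ ≤ #T := hκ.trans hκT
  obtain ⟨g⟩ : Nonempty ((#T).ord.ToType ≃ T) := Cardinal.eq.1 (mk_ord_toType _)
  have hx : ∀ a, ∃ x : X, ∀ b ≤ a, x ∉ (g b : Set X) := by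
    intro a
    by_contra! hcov
    refine ((mk_image_le (f := fun b => (g b : Set X)) (s := Set.Iic a)).trans_lt
      (mk_Iic_toType_ord_lt hT a)).not_ge (hmin _ ?_ ?_)
    · rintro _ ⟨b, -, rfl⟩
      exact hTS (g b).2
    · refine Set.eq_univ_of_forall fun x => ?_
      obtain ⟨b, hb, hxb⟩ := hcov x
      exact ⟨_, ⟨b, hb, rfl⟩, hxb⟩
  choose x hx using hx
  have hcof : ∀ C : Set (#T).ord.ToType, IsCofinal C → #T ≤ #(x '' C) := by
    intro C hC
    obtain ⟨T', hS', hle, hX'⟩ := exists_subcover_mk_le (B := x '' C) hSc hSX hTS hTX fun U hU => by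
      obtain ⟨c, hcC, hc⟩ := hC (g.symm ⟨U, hU⟩)
      exact ⟨x c, ⟨c, hcC, rfl⟩, by simpa using hx c _ hc⟩
    exact (hmin T' hS' hX').trans hle
  have hreg : (#T).IsRegular := by
    refine ⟨hT, ?_⟩
    rw [← Ordinal.cof_toType, Order.le_cof_iff]
    exact fun C hC => (hcof C hC).trans mk_image_le
  have hB : #(Set.range x) = #T := by
    refine le_antisymm (mk_range_le.trans_eq (mk_ord_toType _)) ?_
    rw [← Set.image_univ]
    exact hcof _ .univ
  obtain ⟨p, hp⟩ := h (Set.range x) (hB.symm ▸ hreg) (hB.symm ▸ hκT)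
  obtain ⟨U, hU, hpU⟩ : p ∈ ⋃₀ T := hTX ▸ Set.mem_univ p
  have hsub : U ∩ Set.range x ⊆ x '' Set.Iio (g.symm ⟨U, hU⟩) := by
    rintro _ ⟨hxU, a, rfl⟩
    refine ⟨a, lt_of_not_ge fun ha => hx a _ ha ?_, rfl⟩
    simpa using hxU
  refine ((mk_le_mk_of_subset hsub).trans mk_image_le).not_gt ?_
  rw [hp U (hSo U (hTS hU)) hpU, hB]
  simpa using mk_Iio_lt (g.symm ⟨U, hU⟩) (by simp)

/-- If every open chain cover has a subcover of cardinality less than `κ`, then every set of regular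
cardinality at least `κ` has a complete accumulation point. -/
theorem LinLle.exists_completeAccPt {X : Type u} [TopologicalSpace X] {κ : Cardinal.{u}}
    (h : LinLle X κ) {B : Set X} (hB : (#B).IsRegular) (hκB : κ ≤ #B) :
    ∃ x : X, ∀ U : Set X, IsOpen U → x ∈ U → #(U ∩ B : Set X) = #B := by
  by_contra! hno
  obtain ⟨f⟩ : Nonempty (B ≃ (#B).ord.ToType) := Cardinal.eq.1 (mk_ord_toType _).symm
  have hbdd : ∀ C : Set (#B).ord.ToType, #C < #B → ∃ a, ∀ c ∈ C, c < a := by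
    intro C hC
    rw [← not_isCofinal_iff]
    intro hcof
    refine hC.not_ge (hB.le_cof_ord.trans ?_)
    rw [← Ordinal.cof_toType]
    exact Order.cof_le hcof
  let V : (#B).ord.ToType → Set X := fun a => interior {x | ∀ hx : x ∈ B, f ⟨x, hx⟩ < a}
  have hV : Monotone V := fun a b hab =>
    interior_mono fun x hx hxB => (hx hxB).trans_le hab
  obtain ⟨T, hTS, hT, hTX⟩ := h (Set.range V) (by rintro _ ⟨a, rfl⟩; exact isOpen_interior)
    hV.isChain_range (Set.eq_univ_of_forall fun x => by
      obtain ⟨U, hUo, hxU, hU⟩ := hno x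
      have hlt : #(U ∩ B : Set X) < #B :=
        lt_of_le_of_ne (mk_le_mk_of_subset Set.inter_subset_right) hU
      obtain ⟨a, ha⟩ := hbdd (Set.range fun y : (U ∩ B : Set X) => f ⟨y, y.2.2⟩)
        (mk_range_le.trans_lt hlt)
      have hUV : U ⊆ {y | ∀ hy : y ∈ B, f ⟨y, hy⟩ < a} :=
        fun y hy hyB => ha _ ⟨⟨y, hy, hyB⟩, rfl⟩
      exact ⟨V a, ⟨a, rfl⟩, interior_maximal hUV hUo hxU⟩)
  choose i hi using fun W : T => hTS W.2
  obtain ⟨a, ha⟩ := hbdd (Set.range i) (mk_range_le.trans_lt (hT.trans_le hκB))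
  obtain ⟨W, hW, hfW⟩ : (f.symm a : X) ∈ ⋃₀ T := hTX ▸ Set.mem_univ _
  replace hfW : (f.symm a : X) ∈ V (i ⟨W, hW⟩) := (hi ⟨W, hW⟩).symm ▸ hfW
  have hai : a < i ⟨W, hW⟩ := by simpa using interior_subset hfW (f.symm a).2
  exact hai.not_gt (ha _ ⟨_, rfl⟩)

theorem stmt_18 (X : Type u) [TopologicalSpace X] (κ : Cardinal.{u}) (hκ : κ.IsRegular) :
    (∀ B : Set X, (#B).IsRegular → κ ≤ #B →
        ∃ x : X, ∀ U : Set X, IsOpen U → x ∈ U → #(U ∩ B : Set X) = #B) ↔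
      LinLle X κ := by
  exact ⟨linLle_of_forall_exists_completeAccPt hκ.aleph0_le, fun h _ => h.exists_completeAccPt⟩
end

section
/- A topological space X is compact if and only if it is linearly compact, i.e. every open cover of X that is a chain under inclusion has a finite subcover. -/
universe u

open Cardinal

/-- A nonempty finite chain of sets contains its own union. -/
theorem IsChain.sUnion_mem_of_finite {X : Type u} {T : Set (Set X)} (hT : IsChain (· ⊆ ·) T)
    (hfin : T.Finite) (hne : T.Nonempty) : ⋃₀ T ∈ T := by
  obtain ⟨U, hU⟩ := hfin.exists_maximal hne
  have hsub : ⋃₀ T ⊆ U := Set.sUnion_subset fun V hV =>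
    (hT.total hV hU.prop).elim id fun h => hU.le_of_ge hV h
  rw [hsub.antisymm (Set.subset_sUnion_of_mem hU.prop)]
  exact hU.prop

/-- If every open cover that is a chain has a finite subcover, then so does every open cover.
The proof is by induction on the cardinality of the index type: well-order it by its initial
ordinal and consider the chain of unions over its initial segments. -/
theorem exists_finite_subcover_of_chain_covers {X : Type u} [TopologicalSpace X]
    (hX : ∀ S : Set (Set X), (∀ U ∈ S, IsOpen U) → IsChain (· ⊆ ·) S → ⋃₀ S = Set.univ →
      ∃ T ⊆ S, T.Finite ∧ ⋃₀ T = Set.univ)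
    {ι : Type u} (U : ι → Set X) (hopen : ∀ i, IsOpen (U i)) (hcover : ⋃ i, U i = Set.univ) :
    ∃ J : Set ι, J.Finite ∧ ⋃ i ∈ J, U i = Set.univ := by
  induction hκ : #ι using WellFoundedLT.induction generalizing ι with
  | ind κ ih =>
  subst hκ
  obtain _ | _ := finite_or_infinite ι
  · exact ⟨Set.univ, Set.finite_univ, by simpa using hcover⟩
  have hinf : ℵ₀ ≤ #ι := Cardinal.aleph0_le_mk ι
  obtain ⟨_, _, hord⟩ := Cardinal.exists_ord_eq_type_lt ι
  have Iic_lt (a : ι) : #(Set.Iic a) < #ι := by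
    rw [← Set.Iio_insert]
    exact Cardinal.mk_insert_le.trans_lt
      (Cardinal.add_lt_of_lt hinf (Cardinal.mk_Iio_lt a hord) (Cardinal.one_lt_aleph0.trans_le hinf))
  let V (a : ι) : Set X := ⋃ i : Set.Iic a, U i
  have V_mono : Monotone V := fun a b hab =>
    Set.iUnion_subset fun i => Set.subset_iUnion (fun i : Set.Iic b => U i) ⟨i, i.2.trans hab⟩
  have V_cover : ⋃₀ Set.range V = Set.univ := by
    refine Set.eq_univ_of_univ_subset (hcover ▸ Set.iUnion_subset fun i => ?_)
    exact (Set.subset_iUnion (fun j : Set.Iic i => U j) ⟨i, le_rfl⟩).trans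
      (Set.subset_sUnion_of_mem ⟨i, rfl⟩)
  obtain ⟨T, hTsub, hTfin, hTcover⟩ := hX (Set.range V)
    (Set.forall_mem_range.2 fun a => isOpen_iUnion fun i => hopen i) V_mono.isChain_range V_cover
  obtain rfl | hne := T.eq_empty_or_nonempty
  · exact ⟨∅, Set.finite_empty, by simpa using hTcover⟩
  obtain ⟨a, ha⟩ := hTsub ((V_mono.isChain_range.mono hTsub).sUnion_mem_of_finite hTfin hne)
  obtain ⟨J, hJfin, hJcover⟩ := ih _ (Iic_lt a) (fun i : Set.Iic a => U i) (fun i => hopen i)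
    (ha.trans hTcover) rfl
  exact ⟨Subtype.val '' J, hJfin.image _, by rwa [Set.biUnion_image]⟩

theorem stmt_19 (X : Type u) [TopologicalSpace X] :
    CompactSpace X ↔
      ∀ S : Set (Set X), (∀ U ∈ S, IsOpen U) → IsChain (· ⊆ ·) S → ⋃₀ S = Set.univ →
        ∃ T ⊆ S, T.Finite ∧ ⋃₀ T = Set.univ := by
  constructor
  · intro _ S hopen _ hcover
    obtain ⟨T, hTS, hTfin, hT⟩ := isCompact_univ.elim_finite_subcover_image (b := S) (c := id)
      hopen (by rw [← hcover, Set.sUnion_eq_biUnion]; rfl)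
    exact ⟨T, hTS, hTfin, Set.eq_univ_of_univ_subset (Set.sUnion_eq_biUnion ▸ hT)⟩
  · intro hX
    refine compactSpace_generateFrom' (TopologicalSpace.generateFrom_setOfPred_isOpen _).symm
      fun ι U hcover => ?_
    exact exists_finite_subcover_of_chain_covers hX (fun i => (U i : Set X)) (fun i => (U i).2)
      hcover
end
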